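/- arXiv:math/0301338 — 3 statements merged into one kernel-verified Lean document; each statement's English description precedes it below -/
import Mathlib

section
/- Let Q ⊆ ℝ³ be a convex polytope (the convex hull of a finite set) with nonempty interior, contained in the closed unit ball centered at the origin. Then for any two points a, b ∈ frontier Q there exists a continuous path γ : [0,1] → frontier Q with γ(0) = a, γ(1) = b whose length (total variation) is less than π. -/
open scoped ENNReal
open Real Set

noncomputable section

/-- Three-dimensional Euclidean space. -/
abbrev E3 := EuclideanSpace ℝ (Fin 3)

/-- The length of a path `γ : [0,1] → ℝ³` is its total variation on `[0,1]`. -/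
def pathLength (γ : ℝ → E3) : ℝ≥0∞ := eVariationOn γ (Set.Icc 0 1)

/-- A unit-speed-bounded path of length parameter `L` inside `S` from `x` to `y`. -/
def LPath (S : Set E3) (x y : E3) (L : ℝ) : Prop :=
  0 ≤ L ∧ ∃ γ : ℝ → E3, (∀ s ∈ Icc 0 L, ∀ t ∈ Icc 0 L, dist (γ s) (γ t) ≤ |s - t|) ∧
    MapsTo γ (Icc 0 L) S ∧ γ 0 = x ∧ γ L = y

lemma LPath.trans {S : Set E3} {x y z : E3} {L M : ℝ} (h1 : LPath S x y L)
    (h2 : LPath S y z M) : LPath S x z (L + M) := by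
  obtain ⟨hL, γ, g1, g2, g3, g4⟩ := h1
  obtain ⟨hM, η, e1, e2, e3, e4⟩ := h2
  refine ⟨by linarith, fun t => if t ≤ L then γ t else η (t - L), ?_, ?_, ?_, ?_⟩
  · have key : ∀ s ∈ Icc 0 (L+M), ∀ t ∈ Icc 0 (L+M), s ≤ L → L < t →
        dist (γ s) (η (t - L)) ≤ t - s := by
      intro s hs t ht h h'
      have a1 := g1 s ⟨hs.1, h⟩ L ⟨hL, le_rfl⟩
      have a2 := e1 0 ⟨le_rfl, hM⟩ (t - L) ⟨by linarith, by linarith [ht.2]⟩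
      rw [abs_of_nonpos (by linarith)] at a1 a2
      rw [g4] at a1
      rw [e3] at a2
      linarith [dist_triangle (γ s) y (η (t-L))]
    intro s hs t ht
    dsimp only
    split_ifs with p q q
    · exact g1 s ⟨hs.1, p⟩ t ⟨ht.1, q⟩
    · rw [abs_sub_comm]
      exact (key s hs t ht p (not_le.1 q)).trans (le_abs_self _)
    · rw [dist_comm]
      exact (key t ht s hs q (not_le.1 p)).trans (le_abs_self _)
    · push Not at p q
      have := e1 (s - L) ⟨by linarith, by linarith [hs.2]⟩ (t - L) ⟨by linarith, by linarith [ht.2]⟩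
      simpa using this
  · intro t ht
    dsimp only
    split_ifs with p
    · exact g2 ⟨ht.1, p⟩
    · push Not at p
      exact e2 ⟨by linarith, by linarith [ht.2]⟩
  · simp [hL, g3]
  · dsimp only
    split_ifs with p
    · have : M = 0 := by linarith
      subst this
      simp [g4, ← e4, e3]
    · simp [e4]

lemma LPath.segment {S : Set E3} {x y : E3} (h : segment ℝ x y ⊆ S) :
    LPath S x y (dist x y) := by
  refine ⟨dist_nonneg, fun t => AffineMap.lineMap x y (t / dist x y), ?_, ?_, ?_, ?_⟩
  · intro s _ t _
    rw [dist_lineMap_lineMap]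
    by_cases hd : dist x y = 0
    · simp [hd]
    · rw [Real.dist_eq, ← sub_div, abs_div, abs_of_nonneg (dist_nonneg : 0 ≤ dist x y),
        div_mul_cancel₀ _ hd]
  · intro t ht
    apply h
    rw [segment_eq_image_lineMap]
    exact ⟨_, ⟨div_nonneg ht.1 dist_nonneg, div_le_one_of_le₀ ht.2 dist_nonneg⟩, rfl⟩
  · simp
  · by_cases hd : x = y
    · simp [hd]
    · have : dist x y ≠ 0 := by simpa using hd
      simp [div_self this]

/-- the great circle -/
def gc (a u : E3) (t : ℝ) : E3 := Real.cos t • a + Real.sin t • u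

lemma gc_inner {a u : E3} (ha : ‖a‖ = 1) (hu : ‖u‖ = 1) (hau : inner ℝ a u = 0) (s t : ℝ) :
    inner ℝ (gc a u s) (gc a u t) = Real.cos (s - t) := by
  have hua : inner ℝ u a = 0 := by rw [real_inner_comm]; exact hau
  simp only [gc, inner_add_left, inner_add_right, inner_smul_left, inner_smul_right, hau, hua,
    real_inner_self_eq_norm_sq, ha, hu, Real.cos_sub]
  simp
  ring

lemma gc_norm {a u : E3} (ha : ‖a‖ = 1) (hu : ‖u‖ = 1) (hau : inner ℝ a u = 0) (s : ℝ) :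
    ‖gc a u s‖ = 1 := by
  have := gc_inner ha hu hau s s
  rw [real_inner_self_eq_norm_sq, sub_self, Real.cos_zero] at this
  nlinarith [norm_nonneg (gc a u s)]

lemma gc_dist_sq {a u : E3} (ha : ‖a‖ = 1) (hu : ‖u‖ = 1) (hau : inner ℝ a u = 0) (s t : ℝ) :
    dist (gc a u s) (gc a u t) ^ 2 = 2 - 2 * Real.cos (s - t) := by
  rw [dist_eq_norm, norm_sub_sq_real, gc_inner ha hu hau, gc_norm ha hu hau, gc_norm ha hu hau]
  ring

lemma gc_dist {a u : E3} (ha : ‖a‖ = 1) (hu : ‖u‖ = 1) (hau : inner ℝ a u = 0) (s t : ℝ) :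
    dist (gc a u s) (gc a u t) ≤ |s - t| := by
  apply abs_le_of_sq_le_sq' _ (abs_nonneg _) |>.2
  rw [gc_dist_sq ha hu hau, sq_abs]
  linarith [Real.one_sub_sq_div_two_le_cos (x := s - t)]

lemma gc_dist_lt {a u : E3} (ha : ‖a‖ = 1) (hu : ‖u‖ = 1) (hau : inner ℝ a u = 0) (s t : ℝ)
    (h : s < t) : dist (gc a u s) (gc a u t) < t - s := by
  apply lt_of_pow_lt_pow_left₀ 2 (by linarith)
  rw [gc_dist_sq ha hu hau]
  have : s - t ≠ 0 := by linarith [h] |> fun (h : s - t < 0) => h.ne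
  linarith [Real.one_sub_sq_div_two_lt_cos this, sq_nonneg (s-t)]

lemma LPath.arc {S : Set E3} {a u : E3} (ha : ‖a‖ = 1) (hu : ‖u‖ = 1) (hau : inner ℝ a u = 0)
    (hS : Metric.sphere 0 1 ⊆ S) {s t : ℝ} (h : s ≤ t) :
    LPath S (gc a u s) (gc a u t) (t - s) := by
  refine ⟨by linarith, fun r => gc a u (s + r), ?_, ?_, by simp, by simp⟩
  · intro p _ q _
    simpa using gc_dist ha hu hau (s + p) (s + q)
  · intro r _
    apply hS
    simpa using gc_norm ha hu hau _

lemma exists_perp (a : E3) : ∃ u : E3, ‖u‖ = 1 ∧ inner ℝ a u = 0 := by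
  have h1 : 0 < Module.finrank ℝ (ℝ ∙ a)ᗮ := by
    have := Submodule.finrank_add_finrank_orthogonal (ℝ ∙ a)
    have h2 := finrank_span_le_card (R := ℝ) ({a} : Set E3)
    rw [Set.toFinset_singleton, Finset.card_singleton] at h2
    simp at this
    omega
  have := Module.finrank_pos_iff.1 h1
  obtain ⟨v, hv⟩ := exists_norm_eq (ℝ ∙ a)ᗮ (zero_le_one)
  exact ⟨v, by simpa using hv, Submodule.mem_orthogonal_singleton_iff_inner_right.1 v.2⟩

/-- paths outside the interior of `Q` -/
lemma outer_path {F : Finset E3} {Q : Set E3} (hQ : Q = convexHull ℝ (F : Set E3))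
    (hsub : Q ⊆ Metric.closedBall (0 : E3) 1) {a b : E3} (ha : ‖a‖ = 1) (hb : ‖b‖ = 1) :
    ∃ L < π, LPath (interior Q)ᶜ a b L := by
  have hclosed : IsClosed Q := by
    rw [hQ]; exact (F.finite_toSet.isCompact_convexHull (𝕜 := ℝ)).isClosed
  have hS : Metric.sphere (0:E3) 1 ⊆ (interior Q)ᶜ := by
    intro x hx hx'
    have := interior_mono hsub hx'
    rw [interior_closedBall _ one_ne_zero] at this
    simp at hx this
    linarith
  by_cases hanti : b = -a
  · obtain ⟨u, hu, hau⟩ := exists_perp a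
    have hinj : InjOn (gc a u) (Ioo 0 π) := by
      intro s hs t ht hst
      by_contra hne
      have h0 := gc_dist_sq ha hu hau s t
      rw [hst, dist_self] at h0
      have : Real.cos (s - t) = 1 := by linarith
      rw [Real.cos_eq_one_iff_of_lt_of_lt (by linarith [hs.1, ht.2, Real.pi_pos])
        (by linarith [hs.2, ht.1, Real.pi_pos])] at this
      exact hne (by linarith)
    have hex : ∃ t ∈ Ioo 0 π, gc a u t ∉ Q := by
      by_contra! hall
      have hsubF : gc a u '' Ioo 0 π ⊆ (F : Set E3) := by
        rintro _ ⟨t, ht, rfl⟩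
        have hq := hall t ht
        rw [hQ] at hq
        apply extremePoints_convexHull_subset (𝕜 := ℝ)
        rw [← hQ] at hq ⊢
        refine inter_extremePoints_subset_extremePoints_of_subset hsub ⟨hq, ?_⟩
        refine ⟨by simpa using (gc_norm ha hu hau t).le, ?_⟩
        intro x₁ hx₁ x₂ hx₂ hx
        have hne : x₁ = x₂ := by
          by_contra hne
          have := (strictConvex_closedBall ℝ (0 : E3) 1).openSegment_subset hx₁ hx₂ hne hx
          rw [interior_closedBall _ one_ne_zero, mem_ball_zero_iff, gc_norm ha hu hau] at this
          exact lt_irrefl _ this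
        subst hne
        rw [openSegment_same] at hx
        exact hx.symm
      exact ((Ioo_infinite Real.pi_pos).image hinj) (F.finite_toSet.subset hsubF)
    obtain ⟨t, ht, hnot⟩ := hex
    obtain ⟨r, hr, hball⟩ := Metric.isOpen_iff.1 hclosed.isOpen_compl _ hnot
    obtain ⟨δ, hδ, hδ2⟩ := exists_between (lt_min hr (sub_pos.2 ht.2))
    obtain ⟨hδr, hδp⟩ := lt_min_iff.1 hδ2
    have hlt := gc_dist_lt ha hu hau t (t + δ) (by linarith)
    have hseg : segment ℝ (gc a u t) (gc a u (t + δ)) ⊆ (interior Q)ᶜ := by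
      refine ((convex_ball (gc a u t) r).segment_subset (by simpa using hr) ?_).trans
        (hball.trans (compl_subset_compl.2 interior_subset))
      rw [Metric.mem_ball, dist_comm]
      linarith
    have p1 := LPath.arc ha hu hau hS ht.1.le
    have p2 := LPath.segment hseg
    have p3 := LPath.arc ha hu hau hS (s := t + δ) (t := π) (by linarith)
    have p := (p1.trans p2).trans p3
    have e1 : gc a u 0 = a := by simp [gc]
    have e2 : gc a u π = b := by simp [gc, hanti]
    rw [e1, e2] at p
    exact ⟨_, by linarith, p⟩
  by_cases hab : a = b
  · subst hab
    have p := LPath.segment (S := (interior Q)ᶜ) (x := a) (y := a)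
      (by simpa using hS (by simpa using ha))
    exact ⟨_, by simpa using Real.pi_pos, p⟩
  · set c : ℝ := inner ℝ a b with hc
    have hc1 : c < 1 := inner_lt_one_iff_real_of_norm_eq_one ha hb |>.2 hab
    have hc2 : -1 < c := by
      have := inner_lt_one_iff_real_of_norm_eq_one (x := a) (y := -b) ha (by simpa using hb) |>.2
        (fun h => hanti (by rw [h]; simp))
      rw [inner_neg_right] at this
      linarith
    set θ := Real.arccos c
    have hcos : Real.cos θ = c := Real.cos_arccos hc2.le hc1.le
    have h0 : 0 < θ := Real.arccos_pos.2 hc1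
    have hpi : θ < π := by
      rcases (Real.arccos_le_pi c).lt_or_eq with h | h
      · exact h
      · rw [Real.arccos_eq_pi] at h; linarith
    have hsin : 0 < Real.sin θ := Real.sin_pos_of_pos_of_lt_pi h0 hpi
    have hsq := Real.sin_sq_add_cos_sq θ
    set u : E3 := (Real.sin θ)⁻¹ • (b - c • a) with hu
    have hau : inner ℝ a u = 0 := by
      simp [hu, inner_smul_right, inner_sub_right, ha, ← hc]
    have hnu : ‖u‖ = 1 := by
      have : ‖b - c • a‖ ^ 2 = Real.sin θ ^ 2 := by
        rw [norm_sub_sq_real, inner_smul_right, real_inner_comm, ← hc, norm_smul, ha, hb]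
        simp only [mul_one, Real.norm_eq_abs, sq_abs]
        rw [hcos] at hsq
        linarith
      rw [hu, norm_smul, (pow_left_inj₀ (norm_nonneg _) hsin.le two_ne_zero).1 this, norm_inv,
        Real.norm_eq_abs, abs_of_pos hsin, inv_mul_cancel₀ hsin.ne']
    have p := LPath.arc ha hnu hau hS h0.le
    have e1 : gc a u 0 = a := by simp [gc]
    have e2 : gc a u θ = b := by
      simp [gc, hu, hcos, smul_smul, mul_inv_cancel₀ hsin.ne']
    rw [e1, e2] at p
    exact ⟨_, by linarith, p⟩

/-- outward point on the sphere projecting to `a` -/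
lemma exists_outer {Q : Set E3} (hconv : Convex ℝ Q) (hint : (interior Q).Nonempty)
    (hclosed : IsClosed Q)
    (hsub : Q ⊆ Metric.closedBall (0 : E3) 1) {a : E3} (ha : a ∈ frontier Q) :
    ∃ a' : E3, ‖a'‖ = 1 ∧ ∀ w ∈ Q, inner ℝ (a' - a) (w - a) ≤ 0 := by
  have haQ : a ∈ Q := hclosed.frontier_subset ha
  obtain ⟨f, hf⟩ := geometric_hahn_banach_open_point hconv.interior isOpen_interior ha.2
  have hf' : ∀ x ∈ Q, f x ≤ f a := by
    intro x hx
    have hx' : x ∈ closure (interior Q) := by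
      rw [hconv.closure_interior_eq_closure_of_nonempty_interior hint]
      exact subset_closure hx
    exact closure_minimal (fun y hy => (hf y hy).le)
      (isClosed_le f.continuous continuous_const) hx'
  set n : E3 := (InnerProductSpace.toDual ℝ E3).symm f with hn
  have hnf : ∀ x, inner ℝ n x = f x := fun x => by simp [hn]
  have hn0 : n ≠ 0 := by
    intro h
    obtain ⟨x, hx⟩ := hint
    have := hf x hx
    rw [← hnf, ← hnf, h] at this
    simp at this
  have hnp : 0 < ‖n‖ := norm_pos_iff.2 hn0
  have hcont : ContinuousOn (fun s : ℝ => ‖a + s • n‖) (Icc 0 (2 / ‖n‖)) := by fun_prop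
  have ha1 : ‖a‖ ≤ 1 := by simpa using hsub haQ
  have hpos : 0 ≤ 2 / ‖n‖ := by positivity
  have hivt := intermediate_value_Icc hpos hcont
  have h1 : (1:ℝ) ∈ Icc ‖a + (0:ℝ) • n‖ ‖a + (2 / ‖n‖) • n‖ := by
    refine ⟨by simpa using ha1, ?_⟩
    have e : ‖(2 / ‖n‖) • n‖ = 2 := by
      rw [norm_smul, Real.norm_of_nonneg hpos, div_mul_cancel₀ _ hnp.ne']
    have := norm_sub_le (a + (2 / ‖n‖) • n) a
    rw [add_sub_cancel_left, e] at this
    linarith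
  obtain ⟨s, hs, hs1⟩ := hivt h1
  refine ⟨a + s • n, hs1, fun w hw => ?_⟩
  rw [add_sub_cancel_left, real_inner_smul_left, inner_sub_right, hnf, hnf]
  exact mul_nonpos_of_nonneg_of_nonpos hs.1 (by linarith [hf' w hw])

/-- **(Bárány–Kuperberg–Zamfirescu).** Any two boundary points of a convex polytope
with nonempty interior contained in the closed unit ball can be joined by a continuous
path on the boundary of length less than `π`. -/
theorem exists_boundary_path_length_lt_pi
    (F : Finset E3) (Q : Set E3) (hQ : Q = convexHull ℝ (F : Set E3))
    (hint : (interior Q).Nonempty)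
    (hsub : Q ⊆ Metric.closedBall (0 : E3) 1)
    (a b : E3) (ha : a ∈ frontier Q) (hb : b ∈ frontier Q) :
    ∃ γ : ℝ → E3, ContinuousOn γ (Set.Icc 0 1) ∧
      Set.MapsTo γ (Set.Icc 0 1) (frontier Q) ∧
      γ 0 = a ∧ γ 1 = b ∧ pathLength γ < ENNReal.ofReal π := by
  have hconv : Convex ℝ Q := by rw [hQ]; exact convex_convexHull ℝ _
  have hclosed : IsClosed Q := by
    rw [hQ]; exact (F.finite_toSet.isCompact_convexHull (𝕜 := ℝ)).isClosed
  have hne : Q.Nonempty := hint.mono interior_subset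
  have hproj : ∀ x : E3, ∃ p ∈ Q, ∀ w ∈ Q, inner ℝ (x - p) (w - p) ≤ 0 := by
    intro x
    obtain ⟨p, hp, h⟩ := exists_norm_eq_iInf_of_complete_convex hne hclosed.isComplete hconv x
    exact ⟨p, hp, (norm_eq_iInf_iff_real_inner_le_zero hconv hp).1 h⟩
  choose P hPQ hP using hproj
  have hlip : ∀ x y p q, p ∈ Q → q ∈ Q → (∀ w ∈ Q, inner ℝ (x - p) (w - p) ≤ 0) →
      (∀ w ∈ Q, inner ℝ (y - q) (w - q) ≤ 0) → dist p q ≤ dist x y := by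
    intro x y p q hp hq h1 h2
    have a1 := h1 q hq
    have a2 := h2 p hp
    have key : ‖p - q‖ ^ 2 ≤ inner ℝ (x - y) (p - q) := by
      have e : inner ℝ (x - y) (p - q) = ‖p - q‖ ^ 2 - inner ℝ (x - p) (q - p)
          - inner ℝ (y - q) (p - q) := by
        rw [← real_inner_self_eq_norm_sq]
        simp only [inner_sub_left, inner_sub_right]
        ring
      linarith
    have cs := real_inner_le_norm (x - y) (p - q)
    rw [dist_eq_norm, dist_eq_norm]
    by_contra! hlt
    nlinarith [norm_nonneg (x - y), norm_nonneg (p - q)]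
  have huniq : ∀ x p, p ∈ Q → (∀ w ∈ Q, inner ℝ (x - p) (w - p) ≤ 0) → P x = p := by
    intro x p hp h
    have := hlip x x (P x) p (hPQ x) hp (hP x) h
    rw [dist_self] at this
    exact dist_le_zero.1 this
  have hfr : ∀ x, x ∉ interior Q → P x ∈ frontier Q := by
    intro x hx
    refine ⟨subset_closure (hPQ x), fun hi => hx ?_⟩
    suffices h : x = P x by rw [h]; exact hi
    obtain ⟨r, hr, hball⟩ := Metric.isOpen_iff.1 isOpen_interior _ hi
    by_contra hxp
    have hv : 0 < ‖x - P x‖ := norm_pos_iff.2 (sub_ne_zero.2 hxp)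
    have hε : 0 < r / (2 * ‖x - P x‖) := by positivity
    have hmem : P x + (r / (2 * ‖x - P x‖)) • (x - P x) ∈ Q := by
      apply interior_subset (hball _)
      rw [Metric.mem_ball, dist_eq_norm, add_sub_cancel_left, norm_smul,
        Real.norm_of_nonneg hε.le]
      have : r / (2 * ‖x - P x‖) * ‖x - P x‖ = r / 2 := by field_simp
      linarith
    have := hP x _ hmem
    rw [add_sub_cancel_left, real_inner_smul_right, real_inner_self_eq_norm_sq] at this
    have : 0 < r / (2 * ‖x - P x‖) * ‖x - P x‖ ^ 2 := by positivity
    linarith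
  obtain ⟨a', ha1, ha2⟩ := exists_outer hconv hint hclosed hsub ha
  obtain ⟨b', hb1, hb2⟩ := exists_outer hconv hint hclosed hsub hb
  obtain ⟨L, hLπ, hL, γ, g1, g2, g3, g4⟩ := outer_path hQ hsub ha1 hb1
  have hscale : MapsTo (fun t : ℝ => L * t) (Icc 0 1) (Icc 0 L) := fun t ht =>
    ⟨mul_nonneg hL ht.1, mul_le_of_le_one_right hL ht.2⟩
  have hl : LipschitzOnWith 1 (fun t => P (γ t)) (Icc 0 L) := by
    apply LipschitzOnWith.of_dist_le_mul
    intro s hs t ht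
    have := hlip (γ s) (γ t) _ _ (hPQ _) (hPQ _) (hP _) (hP _)
    rw [Real.dist_eq]
    simpa using this.trans (g1 s hs t ht)
  refine ⟨fun t => P (γ (L * t)), ?_, ?_, ?_, ?_, ?_⟩
  · exact hl.continuousOn.comp (f := fun t : ℝ => L * t) (by fun_prop) hscale
  · intro t ht
    exact hfr _ (g2 (hscale ht))
  · simp only [mul_zero, g3]
    exact huniq _ _ (hclosed.frontier_subset ha) ha2
  · simp only [mul_one, g4]
    exact huniq _ _ (hclosed.frontier_subset hb) hb2
  · have h1 := hl.comp_eVariationOn_le hscale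
    have hm : MonotoneOn (fun t : ℝ => L * t) (Icc 0 1) := fun s _ t _ h =>
      mul_le_mul_of_nonneg_left h hL
    have h2 := hm.eVariationOn_eq (a := 0) (b := 1) (by simp) (by simp)
    rw [inter_self] at h2
    simp only [ENNReal.coe_one, one_mul, mul_one, mul_zero, sub_zero] at h1 h2
    exact (h1.trans h2.le).trans_lt ((ENNReal.ofReal_lt_ofReal_iff Real.pi_pos).2 hLπ)
end
end

section
/- Fix 0 < ε < √2/(8π) and g > 0. In ℝ³ define the parabolas A₁ = {(s, s², −ε) : s ∈ ℝ} and A₂ = {(s, s², ε) : s ∈ ℝ}, the surface Γ = {(x₁, x₂, x₃) : (x₂ − ε)² + x₃² = 2ε², −1/2 ≤ x₁ ≤ 1/2, x₂ ≤ 0}, and let U be the closed convex hull of A₁ ∪ A₂ ∪ Γ. Set v₁ = (0, 0, −ε), v₂ = (0, 0, ε), b₁ = (0, 1/8, −ε), and let G be the line {(t, g, ε) : t ∈ ℝ}. Then every shortest path on frontier U joining a point of G with b₁ — that is, every continuous path γ : [0,1] → frontier U with γ(0) ∈ G and γ(1) = b₁ whose length equals the infimum of the lengths of all continuous paths in frontier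 U joining a point of G with b₁ — passes through both v₁ and v₂; moreover any two such length-minimizing paths have the same image (the shortest path is unique as a set). -/
open scoped ENNReal
open Real Set

noncomputable section

/-- The point of `ℝ³` with coordinates `(a, b, c)`. -/
def pt (a b c : ℝ) : E3 := (WithLp.equiv 2 (Fin 3 → ℝ)).symm ![a, b, c]

/-- The parabola `x₂ = x₁²` in the plane `x₃ = (-1)^i ε` (here `h = ±ε`). -/
def parabolaA (h : ℝ) : Set E3 := {p | ∃ s : ℝ, p = pt s (s ^ 2) h}

/-- The quarter-cylinder surface `Γ`. -/
def gammaSurf (ε : ℝ) : Set E3 :=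
  {p | (p 1 - ε) ^ 2 + (p 2) ^ 2 = 2 * ε ^ 2 ∧
    -(1 / 2) ≤ p 0 ∧ p 0 ≤ 1 / 2 ∧ p 1 ≤ 0}

/-- The convex body `U`: the closed convex hull of `A₁ ∪ A₂ ∪ Γ`. -/
def bodyU (ε : ℝ) : Set E3 :=
  closure (convexHull ℝ (parabolaA (-ε) ∪ parabolaA ε ∪ gammaSurf ε))

/-- The line `G = {(t, g, ε) : t ∈ ℝ}`. -/
def lineG (g ε : ℝ) : Set E3 := {p | ∃ t : ℝ, p = pt t g ε}

/-- `γ` is a shortest path in `S` from the set `Gs` to the point `b`: it is a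
continuous path in `S` starting in `Gs` and ending at `b` whose length equals the
infimum of the lengths of all such paths. -/
def IsShortestFromSetTo (S Gs : Set E3) (b : E3) (γ : ℝ → E3) : Prop :=
  ContinuousOn γ (Set.Icc 0 1) ∧ Set.MapsTo γ (Set.Icc 0 1) S ∧
    γ 0 ∈ Gs ∧ γ 1 = b ∧
    pathLength γ = sInf {L | ∃ δ : ℝ → E3, ContinuousOn δ (Set.Icc 0 1) ∧
      Set.MapsTo δ (Set.Icc 0 1) S ∧ δ 0 ∈ Gs ∧ δ 1 = b ∧ L = pathLength δ}

lemma pt_0 (a b c : ℝ) : (pt a b c) 0 = a := by simp [pt]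
lemma pt_1 (a b c : ℝ) : (pt a b c) 1 = b := by simp [pt]
lemma pt_2 (a b c : ℝ) : (pt a b c) 2 = c := by simp [pt]

lemma e3_ext {p q : E3} (h0 : p 0 = q 0) (h1 : p 1 = q 1) (h2 : p 2 = q 2) : p = q := by
  ext i; fin_cases i <;> assumption

lemma e3_eta (p : E3) : p = pt (p 0) (p 1) (p 2) := by
  apply e3_ext <;> simp [pt_0, pt_1, pt_2]

lemma e3_dist (p q : E3) :
    dist p q = √((p 0 - q 0) ^ 2 + (p 1 - q 1) ^ 2 + (p 2 - q 2) ^ 2) := by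
  rw [EuclideanSpace.dist_eq, Fin.sum_univ_three]
  simp [Real.dist_eq, sq_abs]

lemma cont_coord (i : Fin 3) : Continuous (fun p : E3 => p i) := by fun_prop

lemma cont_pt {X : Type*} [TopologicalSpace X] {f g h : X → ℝ} (hf : Continuous f)
    (hg : Continuous g) (hh : Continuous h) : Continuous (fun x => pt (f x) (g x) (h x)) := by
  unfold pt
  apply (PiLp.continuous_toLp 2 _).comp
  apply continuous_pi
  intro i
  fin_cases i <;> simpa

/-! ### Lengths -/

def len (γ : ℝ → E3) (a b : ℝ) : ℝ := (eVariationOn γ (Icc a b)).toReal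

lemma bv_sub {γ : ℝ → E3} (h : eVariationOn γ (Icc 0 1) ≠ ⊤) {a b : ℝ} (ha : 0 ≤ a) (hb : b ≤ 1) :
    eVariationOn γ (Icc a b) ≠ ⊤ :=
  ne_top_of_le_ne_top h (eVariationOn.mono γ (Icc_subset_Icc ha hb))

lemma len_add {γ : ℝ → E3} (h : eVariationOn γ (Icc 0 1) ≠ ⊤) {a b c : ℝ} (ha : 0 ≤ a)
    (hab : a ≤ b) (hbc : b ≤ c) (hc : c ≤ 1) : len γ a b + len γ b c = len γ a c := by
  unfold len
  rw [← ENNReal.toReal_add (bv_sub h ha (hbc.trans hc)) (bv_sub h (ha.trans hab) hc)]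
  have := eVariationOn.Icc_add_Icc γ (s := univ) hab hbc (mem_univ b)
  simp only [univ_inter] at this
  rw [this]

lemma dist_le_len {γ : ℝ → E3} (h : eVariationOn γ (Icc 0 1) ≠ ⊤) {a b : ℝ} (ha : 0 ≤ a)
    (hab : a ≤ b) (hb : b ≤ 1) : dist (γ a) (γ b) ≤ len γ a b := by
  unfold len
  rw [dist_edist]
  exact ENNReal.toReal_mono (bv_sub h ha hb)
    (eVariationOn.edist_le γ (left_mem_Icc.2 hab) (right_mem_Icc.2 hab))

lemma mink (A B x y : ℝ) : √((A + B) ^ 2 + (x + y) ^ 2) ≤ √(A ^ 2 + x ^ 2) + √(B ^ 2 + y ^ 2) := by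
  have h1 : 0 ≤ A ^ 2 + x ^ 2 := by positivity
  have h2 : 0 ≤ B ^ 2 + y ^ 2 := by positivity
  rw [Real.sqrt_le_left (by positivity)]
  have h3 : A * B + x * y ≤ √(A ^ 2 + x ^ 2) * √(B ^ 2 + y ^ 2) := by
    rw [← Real.sqrt_mul h1]
    apply Real.le_sqrt_of_sq_le
    nlinarith [sq_nonneg (A * y - B * x)]
  nlinarith [Real.sq_sqrt h1, Real.sq_sqrt h2]

lemma cyl_n {γ : ℝ → E3} (h : eVariationOn γ (Icc 0 1) ≠ ⊤) (x θ : ℝ → ℝ) (R e : ℝ) (n : ℕ) :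
    ∀ a b : ℝ, 0 ≤ a → a ≤ b → b ≤ 1 → ContinuousOn θ (Icc a b) →
    (∀ t ∈ Icc a b, γ t = pt (x t) (e - R * cos (θ t)) (R * sin (θ t))) →
    √((2 ^ n * (2 * R * sin ((θ b - θ a) / 2 ^ (n + 1)))) ^ 2 + (x b - x a) ^ 2) ≤ len γ a b := by
  induction n with
  | zero =>
    intro a b ha hab hb hc hγ
    refine le_trans (le_of_eq ?_) (dist_le_len h ha hab hb)
    rw [e3_dist, hγ a (left_mem_Icc.2 hab), hγ b (right_mem_Icc.2 hab)]
    simp only [pt_0, pt_1, pt_2]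
    congr 1
    have h1 : sin ((θ b - θ a) / 2) ^ 2 = (1 - cos (θ b - θ a)) / 2 := by
      rw [Real.sin_sq_eq_half_sub]; ring_nf
    have h2 := Real.cos_sub (θ b) (θ a)
    have h3 := Real.sin_sq_add_cos_sq (θ a)
    have h4 := Real.sin_sq_add_cos_sq (θ b)
    simp only [pow_zero, one_mul, zero_add, pow_one, mul_pow]
    rw [h1, h2]
    linear_combination (-R ^ 2) * h3 - R ^ 2 * h4
  | succ n ih =>
    intro a b ha hab hb hc hγ
    have hm : (θ a + θ b) / 2 ∈ uIcc (θ a) (θ b) := by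
      rw [mem_uIcc]
      rcases le_total (θ a) (θ b) with h | h
      · left; constructor <;> linarith
      · right; constructor <;> linarith
    have hc' := hc
    rw [← uIcc_of_le hab] at hc'
    obtain ⟨m, hm1, hm2⟩ := intermediate_value_uIcc hc' hm
    rw [uIcc_of_le hab] at hm1
    have i1 := ih a m ha hm1.1 (hm1.2.trans hb) (hc.mono (Icc_subset_Icc le_rfl hm1.2))
      (fun t ht => hγ t ⟨ht.1, ht.2.trans hm1.2⟩)
    have i2 := ih m b (ha.trans hm1.1) hm1.2 hb (hc.mono (Icc_subset_Icc hm1.1 le_rfl))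
      (fun t ht => hγ t ⟨hm1.1.trans ht.1, ht.2⟩)
    rw [← len_add h ha hm1.1 hm1.2 hb]
    refine le_trans (le_trans (le_of_eq ?_) (mink _ _ _ _)) (add_le_add i1 i2)
    have e1 : (θ m - θ a) / 2 ^ (n + 1) = (θ b - θ a) / 2 ^ (n + 1 + 1) := by
      rw [hm2]; field_simp; ring
    have e2 : (θ b - θ m) / 2 ^ (n + 1) = (θ b - θ a) / 2 ^ (n + 1 + 1) := by
      rw [hm2]; field_simp; ring
    rw [e1, e2]
    congr 1
    ring

lemma lim_sin (R Δ : ℝ) : Filter.Tendsto (fun n : ℕ => (2:ℝ) ^ n * (2 * R * sin (Δ / 2 ^ (n + 1))))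
    Filter.atTop (nhds (R * Δ)) := by
  have h1 : Filter.Tendsto (fun n : ℕ => Δ / (2:ℝ) ^ (n + 1)) Filter.atTop (nhds 0) := by
    have : Filter.Tendsto (fun n : ℕ => (2:ℝ) ^ (n + 1)) Filter.atTop Filter.atTop :=
      (tendsto_pow_atTop_atTop_of_one_lt (by norm_num)).comp (Filter.tendsto_add_atTop_nat 1)
    exact this.const_div_atTop Δ
  have h2 : Filter.Tendsto (fun n : ℕ => R * Δ * sinc (Δ / (2:ℝ) ^ (n + 1))) Filter.atTop
      (nhds (R * Δ * sinc 0)) :=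
    ((Real.continuous_sinc.tendsto 0).comp h1).const_mul _
  rw [Real.sinc_zero, mul_one] at h2
  refine h2.congr (fun n => ?_)
  by_cases hΔ : Δ = 0
  · simp [hΔ]
  · rw [Real.sinc_of_ne_zero (by positivity)]
    field_simp
    ring

lemma cyl {γ : ℝ → E3} (h : eVariationOn γ (Icc 0 1) ≠ ⊤) (x θ : ℝ → ℝ) (R e : ℝ)
    (a b : ℝ) (ha : 0 ≤ a) (hab : a ≤ b) (hb : b ≤ 1) (hc : ContinuousOn θ (Icc a b))
    (hγ : ∀ t ∈ Icc a b, γ t = pt (x t) (e - R * cos (θ t)) (R * sin (θ t))) :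
    √((R * (θ b - θ a)) ^ 2 + (x b - x a) ^ 2) ≤ len γ a b := by
  have h1 := ((lim_sin R (θ b - θ a)).pow 2).add_const ((x b - x a) ^ 2)
  have h2 := (Real.continuous_sqrt.tendsto _).comp h1
  exact le_of_tendsto' h2 (fun n => cyl_n h x θ R e n a b ha hab hb hc hγ)

/-! ### The body -/

def arc (ε h : ℝ) : ℝ := ε - √(2 * ε ^ 2 - h ^ 2)

lemma cont_arc (ε : ℝ) : Continuous (arc ε) := by unfold arc; fun_prop

lemma arc_eps {ε : ℝ} (h : 0 < ε) : arc ε ε = 0 := by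
  unfold arc
  rw [show 2 * ε ^ 2 - ε ^ 2 = ε ^ 2 by ring, Real.sqrt_sq h.le]; ring

lemma arc_neg (ε h : ℝ) : arc ε (-h) = arc ε h := by simp [arc]

/-- the region above the arc cylinder, as a closed convex set -/
def reg (ε : ℝ) : Set E3 := {p | p 2 ≤ ε} ∩ {p | -ε ≤ p 2} ∩ {p | arc ε (p 2) ≤ p 1}

lemma bodyU_closed (ε : ℝ) : IsClosed (bodyU ε) := isClosed_closure

lemma bodyU_convex (ε : ℝ) : Convex ℝ (bodyU ε) := (convex_convexHull ℝ _).closure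

lemma reg_closed (ε : ℝ) : IsClosed (reg ε) := by
  refine ((isClosed_le (cont_coord 2) continuous_const).inter
    (isClosed_le continuous_const (cont_coord 2))).inter
    (isClosed_le ((cont_arc ε).comp (cont_coord 2)) (cont_coord 1))

lemma reg_convex {ε : ℝ} (hε : 0 < ε) : Convex ℝ (reg ε) := by
  rintro p ⟨⟨hp1, hp2⟩, hp3⟩ q ⟨⟨hq1, hq2⟩, hq3⟩ a b ha hb hab
  simp only [mem_ofPred_eq, arc] at hp1 hp2 hp3 hq1 hq2 hq3
  refine ⟨⟨?_, ?_⟩, ?_⟩ <;> simp only [mem_ofPred_eq, arc, PiLp.add_apply, PiLp.smul_apply, smul_eq_mul]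
  · calc _ ≤ a * ε + b * ε := by gcongr
      _ = ε := by rw [← add_mul, hab, one_mul]
  · calc _ ≥ a * (-ε) + b * (-ε) := by gcongr
      _ = -ε := by rw [← add_mul, hab, one_mul]
  · have kp : 0 ≤ 2 * ε ^ 2 - p 2 ^ 2 := by nlinarith
    have kq : 0 ≤ 2 * ε ^ 2 - q 2 ^ 2 := by nlinarith
    have key : a * √(2 * ε ^ 2 - p 2 ^ 2) + b * √(2 * ε ^ 2 - q 2 ^ 2) ≤
        √(2 * ε ^ 2 - (a * p 2 + b * q 2) ^ 2) := by
      apply Real.le_sqrt_of_sq_le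
      have s1 := Real.sq_sqrt kp
      have s2 := Real.sq_sqrt kq
      set P := √(2 * ε ^ 2 - p 2 ^ 2)
      set Q := √(2 * ε ^ 2 - q 2 ^ 2)
      have hb' : b = 1 - a := by linarith
      subst hb'
      nlinarith [mul_nonneg (mul_nonneg ha hb) (add_nonneg (sq_nonneg (P - Q)) (sq_nonneg (p 2 - q 2)))]
    have e1 := mul_le_mul_of_nonneg_left hp3 ha
    have e2 := mul_le_mul_of_nonneg_left hq3 hb
    have : ε = a * ε + b * ε := by rw [← add_mul, hab, one_mul]
    linarith

lemma bodyU_sub {ε : ℝ} (hε : 0 < ε) : bodyU ε ⊆ reg ε := by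
  refine closure_minimal (convexHull_min ?_ (reg_convex hε)) (reg_closed ε)
  rintro p ((⟨s, rfl⟩ | ⟨s, rfl⟩) | ⟨h1, -, -, h2⟩)
  · refine ⟨⟨?_, ?_⟩, ?_⟩ <;> simp only [mem_ofPred_eq, pt_1, pt_2, arc_neg, arc_eps hε]
    · linarith
    · rfl
    · positivity
  · refine ⟨⟨?_, ?_⟩, ?_⟩ <;> simp only [mem_ofPred_eq, pt_1, pt_2, arc_eps hε]
    · rfl
    · linarith
    · positivity
  · have : p 2 ^ 2 ≤ ε ^ 2 := by nlinarith
    have := abs_le_of_sq_le_sq' this hε.le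
    refine ⟨⟨this.2, this.1⟩, ?_⟩
    simp only [mem_ofPred_eq, arc]
    rw [show 2 * ε ^ 2 - p 2 ^ 2 = (ε - p 1) ^ 2 by linarith, Real.sqrt_sq (by linarith)]
    linarith

lemma comb_mem {ε : ℝ} {p q r : E3} (hp : p ∈ bodyU ε) (hq : q ∈ bodyU ε) (a b : ℝ)
    (ha : 0 ≤ a) (hb : 0 ≤ b) (hab : a + b = 1) (h0 : r 0 = a * p 0 + b * q 0)
    (h1 : r 1 = a * p 1 + b * q 1) (h2 : r 2 = a * p 2 + b * q 2) : r ∈ bodyU ε := by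
  have := bodyU_convex ε hp hq ha hb hab
  convert this using 1
  apply e3_ext <;> simp [h0, h1, h2]

lemma gen_mem {ε : ℝ} {p : E3} (h : p ∈ parabolaA (-ε) ∪ parabolaA ε ∪ gammaSurf ε) :
    p ∈ bodyU ε := subset_closure (subset_convexHull ℝ _ h)

lemma face_mem {ε e r y : ℝ} (he : e = ε ∨ e = -ε) (hy : r ^ 2 ≤ y) : pt r y e ∈ bodyU ε := by
  have hy0 : 0 ≤ y := (sq_nonneg r).trans hy
  have par : ∀ s : ℝ, pt s (s ^ 2) e ∈ bodyU ε := by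
    intro s
    apply gen_mem
    rcases he with rfl | rfl
    · exact Or.inl (Or.inr ⟨s, rfl⟩)
    · exact Or.inl (Or.inl ⟨s, rfl⟩)
  rcases hy0.eq_or_lt with h | h
  · have : r = 0 := by nlinarith
    subst this; subst h
    simpa using par 0
  · have hs := Real.sqrt_pos.2 h
    have hss := Real.sq_sqrt hy0
    have hr := abs_le.1 (Real.abs_le_sqrt hy)
    refine comb_mem (par (√y)) (par (-√y)) ((√y + r) / (2 * √y)) ((√y - r) / (2 * √y))
      (div_nonneg (by linarith [hr.1]) (by positivity))
      (div_nonneg (by linarith [hr.2]) (by positivity)) ?_ ?_ ?_ ?_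
    · field_simp; ring
    · simp only [pt_0]; field_simp; ring
    · simp only [pt_1, neg_sq, hss]; field_simp; ring
    · simp only [pt_2]; field_simp; ring

lemma slab_mem {ε r y h : ℝ} (hε : 0 < ε) (h1 : -ε ≤ h) (h2 : h ≤ ε) (hy : r ^ 2 ≤ y) :
    pt r y h ∈ bodyU ε := by
  refine comb_mem (face_mem (Or.inl rfl) hy) (face_mem (Or.inr rfl) hy) ((ε + h) / (2 * ε))
    ((ε - h) / (2 * ε)) (div_nonneg (by linarith) (by positivity))
      (div_nonneg (by linarith) (by positivity)) ?_ ?_ ?_ ?_ <;>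
  (try simp only [pt_0, pt_1, pt_2]) <;> field_simp <;> ring

lemma arc_mem {ε r h : ℝ} (_hε : 0 < ε) (h1 : -ε ≤ h) (h2 : h ≤ ε) (hr1 : -(1 / 2) ≤ r)
    (hr2 : r ≤ 1 / 2) : pt r (arc ε h) h ∈ bodyU ε := by
  have k : ε ^ 2 ≤ 2 * ε ^ 2 - h ^ 2 := by nlinarith
  apply gen_mem
  refine Or.inr ⟨?_, ?_, ?_, ?_⟩ <;> simp only [pt_0, pt_1, pt_2, arc]
  · have := Real.sq_sqrt ((sq_nonneg ε).trans k)
    nlinarith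
  · exact hr1
  · exact hr2
  · have := Real.le_sqrt_of_sq_le k
    linarith

lemma above_mem {ε r y h : ℝ} (hε : 0 < ε) (h1 : -ε ≤ h) (h2 : h ≤ ε) (hr1 : -(1 / 2) ≤ r)
    (hr2 : r ≤ 1 / 2) (hy : arc ε h ≤ y) : pt r y h ∈ bodyU ε := by
  set M := max (y + 1) (r ^ 2) with hM
  have hM1 : y + 1 ≤ M := le_max_left _ _
  have hM2 : r ^ 2 ≤ M := le_max_right _ _
  have hpos : 0 < M - arc ε h := by linarith
  refine comb_mem (arc_mem hε h1 h2 hr1 hr2) (slab_mem hε h1 h2 hM2) ((M - y) / (M - arc ε h))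
    ((y - arc ε h) / (M - arc ε h)) (div_nonneg (by linarith) hpos.le)
      (div_nonneg (by linarith) hpos.le) ?_ ?_ ?_ ?_ <;>
  (try simp only [pt_0, pt_1, pt_2]) <;> field_simp <;> ring

/-- frontier points strictly between the planes lie below the parabolic cylinder -/
lemma frontier_par {ε : ℝ} (hε : 0 < ε) {p : E3} (hp : p ∈ frontier (bodyU ε)) (h1 : -ε < p 2)
    (h2 : p 2 < ε) : p 1 ≤ p 0 ^ 2 := by
  by_contra hlt
  push Not at hlt
  apply hp.2
  rw [mem_interior]
  refine ⟨{q | -ε < q 2} ∩ {q | q 2 < ε} ∩ {q | q 0 ^ 2 < q 1}, ?_, ?_, ⟨⟨h1, h2⟩, hlt⟩⟩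
  · rintro q ⟨⟨a, b⟩, c⟩
    rw [e3_eta q]
    exact slab_mem hε (le_of_lt a) (le_of_lt b) (le_of_lt c)
  · exact ((isOpen_lt continuous_const (cont_coord 2)).inter
      (isOpen_lt (cont_coord 2) continuous_const)).inter
      (isOpen_lt ((cont_coord 0).pow 2) (cont_coord 1))

lemma frontier_arc {ε : ℝ} (hε : 0 < ε) {p : E3} (hp : p ∈ frontier (bodyU ε)) (h1 : -ε < p 2)
    (h2 : p 2 < ε) (h3 : p 0 ^ 2 < 1 / 4) : p 1 = arc ε (p 2) := by
  have hU : p ∈ bodyU ε := (bodyU_closed ε).frontier_subset hp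
  apply le_antisymm _ (bodyU_sub hε hU).2
  by_contra hlt
  push Not at hlt
  apply hp.2
  rw [mem_interior]
  refine ⟨{q | -ε < q 2} ∩ {q | q 2 < ε} ∩ {q | q 0 ^ 2 < 1 / 4} ∩ {q | arc ε (q 2) < q 1}, ?_, ?_,
    ⟨⟨⟨h1, h2⟩, h3⟩, hlt⟩⟩
  · rintro q ⟨⟨⟨a, b⟩, c⟩, d⟩
    rw [e3_eta q]
    have c' : q 0 ^ 2 < 1 / 4 := c
    exact above_mem hε (le_of_lt a) (le_of_lt b) (by nlinarith) (by nlinarith) (le_of_lt d)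
  · exact (((isOpen_lt continuous_const (cont_coord 2)).inter
      (isOpen_lt (cont_coord 2) continuous_const)).inter
      (isOpen_lt ((cont_coord 0).pow 2) continuous_const)).inter
      (isOpen_lt ((cont_arc ε).comp (cont_coord 2)) (cont_coord 1))

lemma mem_frontier_of_ray {ε : ℝ} {p v : E3} (hp : p ∈ bodyU ε)
    (hv : ∀ s : ℝ, 0 < s → p + s • v ∉ bodyU ε) : p ∈ frontier (bodyU ε) := by
  refine ⟨subset_closure hp, fun hi => ?_⟩
  have hc : Continuous (fun s : ℝ => p + s • v) := by fun_prop
  have h0 : (fun s : ℝ => p + s • v) ⁻¹' (interior (bodyU ε)) ∈ nhds (0 : ℝ) :=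
    (isOpen_interior.preimage hc).mem_nhds (by simpa using hi)
  obtain ⟨δ, hδ, hsub⟩ := Metric.mem_nhds_iff.1 h0
  have : (δ / 2) ∈ Metric.ball (0:ℝ) δ := by
    rw [Metric.mem_ball, Real.dist_eq, sub_zero, abs_of_pos (by positivity)]; linarith
  exact hv (δ / 2) (by positivity) (interior_subset (hsub this))

lemma top_frontier {ε y : ℝ} (hε : 0 < ε) (hy : 0 ≤ y) : pt 0 y ε ∈ frontier (bodyU ε) := by
  refine mem_frontier_of_ray (v := pt 0 0 1) (slab_mem hε (by linarith) le_rfl (by simpa)) ?_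
  intro s hs hm
  have := (bodyU_sub hε hm).1.1
  simp [pt_2] at this
  linarith

lemma bot_frontier {ε y : ℝ} (hε : 0 < ε) (hy : 0 ≤ y) : pt 0 y (-ε) ∈ frontier (bodyU ε) := by
  refine mem_frontier_of_ray (v := pt 0 0 (-1)) (slab_mem hε (le_rfl) (by linarith) (by simpa)) ?_
  intro s hs hm
  have := (bodyU_sub hε hm).1.2
  simp [pt_2] at this
  linarith

lemma arc_frontier {ε h : ℝ} (hε : 0 < ε) (h1 : -ε ≤ h) (h2 : h ≤ ε) :
    pt 0 (arc ε h) h ∈ frontier (bodyU ε) := by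
  refine mem_frontier_of_ray (v := pt 0 (-1) 0) (arc_mem hε h1 h2 (by norm_num) (by norm_num)) ?_
  intro s hs hm
  have := (bodyU_sub hε hm).2
  simp [pt_2, pt_1] at this
  linarith

/-! ### The explicit path -/

lemma R_cos {ε : ℝ} : √2 * ε * cos (π / 4) = ε := by
  rw [Real.cos_pi_div_four]
  have := Real.mul_self_sqrt (show (0:ℝ) ≤ 2 by norm_num)
  linear_combination (ε / 2) * this

lemma R_sin {ε : ℝ} : √2 * ε * sin (π / 4) = ε := by
  rw [Real.sin_pi_div_four]
  have := Real.mul_self_sqrt (show (0:ℝ) ≤ 2 by norm_num)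
  linear_combination (ε / 2) * this

lemma arc_sin {ε θ : ℝ} (hε : 0 < ε) (h1 : -(π / 4) ≤ θ) (h2 : θ ≤ π / 4) :
    arc ε (√2 * ε * sin θ) = ε - √2 * ε * cos θ := by
  unfold arc
  have hc : 0 ≤ cos θ := Real.cos_nonneg_of_neg_pi_div_two_le_of_le
    (by linarith [pi_pos]) (by linarith [pi_pos])
  have h2 := Real.mul_self_sqrt (show (0:ℝ) ≤ 2 by norm_num)
  have : 2 * ε ^ 2 - (√2 * ε * sin θ) ^ 2 = (√2 * ε * cos θ) ^ 2 := by
    linear_combination (-(ε^2)) * h2 - √2 ^ 2 * ε ^ 2 * Real.sin_sq_add_cos_sq θ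
  rw [this, Real.sqrt_sq (by positivity)]

lemma evar_lip (κ : ℝ → E3) {a b K : ℝ} (hab : a ≤ b) (hK : 0 ≤ K)
    (h : ∀ s ∈ Icc a b, ∀ t ∈ Icc a b, dist (κ s) (κ t) ≤ K * dist s t) :
    eVariationOn κ (Icc a b) ≤ ENNReal.ofReal (K * (b - a)) := by
  have hl : LipschitzOnWith K.toNNReal κ (Icc a b) := by
    apply LipschitzOnWith.of_dist_le_mul
    intro s hs t ht
    rw [Real.coe_toNNReal K hK]
    exact h s hs t ht
  have h1 := hl.comp_eVariationOn_le (g := (id : ℝ → ℝ)) (mapsTo_id (Icc a b))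
  have h2 := (monotone_id.monotoneOn (Icc a b)).eVariationOn_le (left_mem_Icc.2 hab)
    (right_mem_Icc.2 hab)
  rw [inter_self] at h2
  rw [ENNReal.ofReal_mul hK]
  exact h1.trans (mul_le_mul_right h2 _)

def clampθ (u : ℝ) : ℝ := max (-(π / 4)) (min (π / 4) u)

def kap (ε : ℝ) (u : ℝ) : E3 :=
  pt 0 (ε - √2 * ε * cos (clampθ u) + max (|u| - π / 4) 0) (√2 * ε * sin (clampθ u))

lemma kap_mid {ε u : ℝ} (h1 : -(π / 4) ≤ u) (h2 : u ≤ π / 4) :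
    kap ε u = pt 0 (ε - √2 * ε * cos u) (√2 * ε * sin u) := by
  have : clampθ u = u := by rw [clampθ, min_eq_right h2, max_eq_right h1]
  rw [kap, this, max_eq_right (by linarith [abs_le.2 ⟨h1, h2⟩]), add_zero]

lemma kap_top {ε u : ℝ} (h1 : π / 4 ≤ u) : kap ε u = pt 0 (u - π / 4) ε := by
  have : clampθ u = π / 4 := by
    rw [clampθ, min_eq_left h1, max_eq_right (by linarith [pi_pos])]
  rw [kap, this, abs_of_nonneg (by linarith [pi_pos]), max_eq_left (by linarith), R_cos, R_sin]
  congr 1; ring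

lemma kap_bot {ε u : ℝ} (h1 : u ≤ -(π / 4)) : kap ε u = pt 0 (-u - π / 4) (-ε) := by
  have : clampθ u = -(π / 4) := by
    rw [clampθ, min_eq_right (by linarith [pi_pos]), max_eq_left (by linarith [pi_pos])]
  rw [kap, this, abs_of_nonpos (by linarith [pi_pos]), max_eq_left (by linarith), cos_neg, sin_neg,
    mul_neg, R_cos, R_sin]
  congr 1; ring

lemma kap_cont (ε : ℝ) : Continuous (kap ε) := by
  unfold kap clampθ
  exact cont_pt continuous_const (by fun_prop) (by fun_prop)

lemma kap_frontier {ε : ℝ} (hε : 0 < ε) (u : ℝ) : kap ε u ∈ frontier (bodyU ε) := by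
  rcases le_total u (-(π / 4)) with h | h
  · rw [kap_bot h]; exact bot_frontier hε (by linarith)
  rcases le_total (π / 4) u with h' | h'
  · rw [kap_top h']; exact top_frontier hε (by linarith)
  rw [kap_mid h h', ← arc_sin hε h h']
  have s1 : sin u ≤ sin (π / 4) := Real.sin_le_sin_of_le_of_le_pi_div_two
    (by linarith [pi_pos]) (by linarith [pi_pos]) h'
  have s2 : sin (-(π / 4)) ≤ sin u := Real.sin_le_sin_of_le_of_le_pi_div_two
    (by linarith [pi_pos]) (by linarith [pi_pos]) h
  have hR : 0 ≤ √2 * ε := by positivity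
  have e := R_sin (ε := ε)
  rw [sin_neg] at s2
  apply arc_frontier hε <;> nlinarith

lemma kap_len {ε g : ℝ} (hε : 0 < ε) (hg : 0 < g) :
    eVariationOn (kap ε) (Icc (-(π / 4) - 1 / 8) (π / 4 + g)) ≤
      ENNReal.ofReal (g + √2 * ε * (π / 2) + 1 / 8) := by
  have hπ := pi_pos
  have hR : 0 ≤ √2 * ε := by positivity
  have A := eVariationOn.Icc_add_Icc (kap ε) (s := univ)
    (a := -(π / 4) - 1 / 8) (b := -(π / 4)) (c := π / 4 + g) (by linarith) (by linarith) (mem_univ _)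
  have B := eVariationOn.Icc_add_Icc (kap ε) (s := univ)
    (a := -(π / 4)) (b := π / 4) (c := π / 4 + g) (by linarith) (by linarith) (mem_univ _)
  simp only [univ_inter] at A B
  rw [← A, ← B]
  have e1 : eVariationOn (kap ε) (Icc (-(π / 4) - 1 / 8) (-(π / 4))) ≤ ENNReal.ofReal (1 / 8) := by
    refine (evar_lip (K := 1) _ (by linarith) zero_le_one ?_).trans (le_of_eq (by ring_nf))
    intro s hs t ht
    rw [kap_bot hs.2, kap_bot ht.2, e3_dist]
    simp only [pt_0, pt_1, pt_2, Real.dist_eq]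
    rw [one_mul, ← Real.sqrt_sq_eq_abs]
    apply le_of_eq; congr 1; ring
  have e3 : eVariationOn (kap ε) (Icc (π / 4) (π / 4 + g)) ≤ ENNReal.ofReal g := by
    refine (evar_lip (K := 1) _ (by linarith) zero_le_one ?_).trans (le_of_eq (by ring_nf))
    intro s hs t ht
    rw [kap_top hs.1, kap_top ht.1, e3_dist]
    simp only [pt_0, pt_1, pt_2, Real.dist_eq]
    rw [one_mul, ← Real.sqrt_sq_eq_abs]
    apply le_of_eq; congr 1; ring
  have e2 : eVariationOn (kap ε) (Icc (-(π / 4)) (π / 4)) ≤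
      ENNReal.ofReal (√2 * ε * (π / 2)) := by
    refine (evar_lip (K := √2 * ε) _ (by linarith) hR ?_).trans (le_of_eq (by ring_nf))
    intro s hs t ht
    rw [kap_mid hs.1 hs.2, kap_mid ht.1 ht.2, e3_dist]
    simp only [pt_0, pt_1, pt_2, Real.dist_eq]
    rw [Real.sqrt_le_left (by positivity), mul_pow, sq_abs]
    have h1 : sin ((s - t) / 2) ^ 2 = (1 - cos (s - t)) / 2 := by
      rw [Real.sin_sq_eq_half_sub]; ring_nf
    have h2 := Real.cos_sub s t
    have h3 := Real.sin_sq_add_cos_sq s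
    have h4 := Real.sin_sq_add_cos_sq t
    have h5 : sin ((s - t) / 2) ^ 2 ≤ ((s - t) / 2) ^ 2 := by
      rw [sq_le_sq]; exact Real.abs_sin_le_abs
    have h6 := mul_le_mul_of_nonneg_left h5 (sq_nonneg (√2 * ε))
    rw [h1, h2] at h6
    refine le_trans (le_of_eq ?_) (le_trans (mul_le_mul_of_nonneg_left h6 (by norm_num : (0:ℝ) ≤ 4))
      (le_of_eq ?_))
    · linear_combination ((√2 * ε) ^ 2) * h3 + ((√2 * ε) ^ 2) * h4
    · ring
  rw [show g + √2 * ε * (π / 2) + 1 / 8 = 1 / 8 + (√2 * ε * (π / 2) + g) by ring,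
    ENNReal.ofReal_add (by norm_num) (by positivity), ENNReal.ofReal_add (by positivity) hg.le]
  exact add_le_add e1 (add_le_add e2 e3)

lemma shortest_le {ε g : ℝ} (hε : 0 < ε) (hg : 0 < g) {γ : ℝ → E3}
    (h : IsShortestFromSetTo (frontier (bodyU ε)) (lineG g ε) (pt 0 (1 / 8) (-ε)) γ) :
    eVariationOn γ (Icc 0 1) ≤ ENNReal.ofReal (g + √2 * ε * (π / 2) + 1 / 8) := by
  obtain ⟨-, -, -, -, h⟩ := h
  unfold pathLength at h
  rw [h]
  have hπ := pi_pos
  set φ : ℝ → ℝ := fun t => (π / 4 + g) - t * (π / 2 + g + 1 / 8) with hφ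
  have hanti : AntitoneOn φ (Icc 0 1) := by
    intro s _ t _ hst
    have : 0 ≤ π / 2 + g + 1 / 8 := by positivity
    simp only [hφ]
    nlinarith
  have hmaps : MapsTo φ (Icc 0 1) (Icc (-(π / 4) - 1 / 8) (π / 4 + g)) := by
    intro t ht
    have : 0 ≤ π / 2 + g + 1 / 8 := by positivity
    simp only [hφ]
    constructor <;> nlinarith [ht.1, ht.2]
  refine le_trans (b := pathLength (kap ε ∘ φ)) (sInf_le ⟨kap ε ∘ φ, ?_, ?_, ?_, ?_, rfl⟩)
    ((eVariationOn.comp_le_of_antitoneOn (kap ε) φ hanti hmaps).trans (kap_len hε hg))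
  · exact ((kap_cont ε).comp (by fun_prop)).continuousOn
  · intro t _; exact kap_frontier hε _
  · refine ⟨0, ?_⟩
    simp only [Function.comp, hφ]
    rw [kap_top (by linarith)]
    congr 1; ring
  · simp only [Function.comp, hφ]
    rw [kap_bot (by linarith)]
    congr 1; ring

/-! ### Straight parts -/

lemma seg_pt {g e : ℝ} {X : E3} (h : dist (pt 0 0 e) X + dist X (pt 0 g e) ≤ g) :
    ∃ y ∈ Icc 0 g, X = pt 0 y e := by
  rw [e3_dist, e3_dist] at h
  simp only [pt_0, pt_1, pt_2] at h
  have a1 : X 1 ≤ √((0 - X 0) ^ 2 + (0 - X 1) ^ 2 + (e - X 2) ^ 2) :=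
    Real.le_sqrt_of_sq_le (by nlinarith [sq_nonneg (X 0), sq_nonneg (e - X 2)])
  have a2 : g - X 1 ≤ √((X 0 - 0) ^ 2 + (X 1 - g) ^ 2 + (X 2 - e) ^ 2) :=
    Real.le_sqrt_of_sq_le (by nlinarith [sq_nonneg (X 0), sq_nonneg (X 2 - e)])
  have b1 : √((0 - X 0) ^ 2 + (0 - X 1) ^ 2 + (e - X 2) ^ 2) ≤ X 1 := by linarith
  have b2 : √((X 0 - 0) ^ 2 + (X 1 - g) ^ 2 + (X 2 - e) ^ 2) ≤ g - X 1 := by linarith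
  have c1 : 0 ≤ X 1 := (Real.sqrt_nonneg _).trans b1
  have c2 : 0 ≤ g - X 1 := (Real.sqrt_nonneg _).trans b2
  rw [Real.sqrt_le_left c1] at b1
  refine ⟨X 1, ⟨c1, by linarith⟩, ?_⟩
  apply e3_ext <;> simp only [pt_0, pt_1, pt_2]
  · nlinarith [sq_nonneg (X 0), sq_nonneg (e - X 2)]
  · nlinarith [sq_nonneg (X 0), sq_nonneg (e - X 2)]

/-- sets swept by the minimizer -/
def segSet (g e : ℝ) : Set E3 := {X | ∃ y ∈ Icc 0 g, X = pt 0 y e}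
def arcSet (ε : ℝ) : Set E3 := {X | ∃ h ∈ Icc (-ε) ε, X = pt 0 (arc ε h) h}

lemma coord_contOn {γ : ℝ → E3} {s : Set ℝ} (h : ContinuousOn γ s) (i : Fin 3) :
    ContinuousOn (fun t => γ t i) s := (cont_coord i).comp_continuousOn h

lemma seg_top {γ : ℝ → E3} (h : eVariationOn γ (Icc 0 1) ≠ ⊤) {a b g e : ℝ} (ha : 0 ≤ a)
    (hab : a ≤ b) (hb : b ≤ 1) (hc : ContinuousOn γ (Icc a b)) (hl : len γ a b ≤ g)
    (hγa : γ a = pt 0 g e) (hγb : γ b = pt 0 0 e) : γ '' Icc a b = segSet g e := by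
  have key : ∀ t ∈ Icc a b, γ t ∈ segSet g e := by
    intro t ht
    apply seg_pt
    have := len_add h ha ht.1 ht.2 hb
    have d1 := dist_le_len h ha ht.1 (ht.2.trans hb)
    have d2 := dist_le_len h (ha.trans ht.1) ht.2 hb
    rw [hγa] at d1; rw [hγb] at d2
    rw [dist_comm (pt 0 0 e), dist_comm _ (pt 0 g e)]
    linarith
  apply Subset.antisymm
  · rintro _ ⟨t, ht, rfl⟩; exact key t ht
  · rintro _ ⟨y, hy, rfl⟩
    have := intermediate_value_Icc' hab (coord_contOn hc 1)
    simp only [hγa, hγb, pt_1] at this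
    obtain ⟨t, ht, hty⟩ := this hy
    obtain ⟨y', _, hX⟩ := key t ht
    refine ⟨t, ht, ?_⟩
    simp only [hX, pt_1] at hty
    rw [hX, hty]

lemma seg_bot {γ : ℝ → E3} (h : eVariationOn γ (Icc 0 1) ≠ ⊤) {a b g e : ℝ} (ha : 0 ≤ a)
    (hab : a ≤ b) (hb : b ≤ 1) (hc : ContinuousOn γ (Icc a b)) (hl : len γ a b ≤ g)
    (hγa : γ a = pt 0 0 e) (hγb : γ b = pt 0 g e) : γ '' Icc a b = segSet g e := by
  have key : ∀ t ∈ Icc a b, γ t ∈ segSet g e := by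
    intro t ht
    apply seg_pt
    have := len_add h ha ht.1 ht.2 hb
    have d1 := dist_le_len h ha ht.1 (ht.2.trans hb)
    have d2 := dist_le_len h (ha.trans ht.1) ht.2 hb
    rw [hγa] at d1; rw [hγb] at d2
    linarith
  apply Subset.antisymm
  · rintro _ ⟨t, ht, rfl⟩; exact key t ht
  · rintro _ ⟨y, hy, rfl⟩
    have := intermediate_value_Icc hab (coord_contOn hc 1)
    simp only [hγa, hγb, pt_1] at this
    obtain ⟨t, ht, hty⟩ := this hy
    obtain ⟨y', _, hX⟩ := key t ht
    refine ⟨t, ht, ?_⟩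
    simp only [hX, pt_1] at hty
    rw [hX, hty]

/-! ### The main argument -/

lemma far_bound {g r y d1 d2 : ℝ} (hr : 1 / 4 ≤ r ^ 2) (hy : y ≤ r ^ 2)
    (h1 : g - y ≤ d1) (h2 : √(r ^ 2 + (y - 1 / 8) ^ 2) ≤ d2) : g + 1 / 4 < d1 + d2 := by
  have : y + 1 / 4 < √(r ^ 2 + (y - 1 / 8) ^ 2) := Real.lt_sqrt_of_sq_lt (by nlinarith)
  linarith

set_option maxHeartbeats 1000000 in
lemma image_eq {ε g : ℝ} (hε : 0 < ε) (hε1 : ε < √2 / (8 * π)) (hg : 0 < g) {γ : ℝ → E3}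
    (hs : IsShortestFromSetTo (frontier (bodyU ε)) (lineG g ε) (pt 0 (1 / 8) (-ε)) γ) :
    γ '' Icc 0 1 = segSet g ε ∪ arcSet ε ∪ segSet (1 / 8) (-ε) := by
  have hπ := pi_pos
  have hle := shortest_le hε hg hs
  have hbv : eVariationOn γ (Icc 0 1) ≠ ⊤ := ne_top_of_le_ne_top ENNReal.ofReal_ne_top hle
  set R := √2 * ε with hR
  have hRpos : 0 < R := by positivity
  have h22 := Real.mul_self_sqrt (show (0:ℝ) ≤ 2 by norm_num)
  have hc8 : R * (π / 2) < 1 / 8 := by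
    rw [lt_div_iff₀ (by positivity)] at hε1
    have : 0 < √2 := by positivity
    nlinarith
  have htot : len γ 0 1 ≤ g + R * (π / 2) + 1 / 8 := by
    unfold len
    refine ENNReal.toReal_le_of_le_ofReal (by positivity) hle
  obtain ⟨hcont, hmaps, ⟨s, hγ0⟩, hγ1, -⟩ := hs
  have c2 := coord_contOn hcont 2
  have hU : ∀ t ∈ Icc (0:ℝ) 1, γ t ∈ reg ε := fun t ht =>
    bodyU_sub hε ((bodyU_closed ε).frontier_subset (hmaps ht))
  -- last time in the top plane
  obtain ⟨t0, ht0, ht0e, ht0max⟩ : ∃ t0 ∈ Icc (0:ℝ) 1, γ t0 2 = ε ∧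
      ∀ t ∈ Icc (0:ℝ) 1, γ t 2 = ε → t ≤ t0 := by
    have hK : IsCompact (Icc (0:ℝ) 1 ∩ (fun t => γ t 2) ⁻¹' {ε}) :=
      isCompact_Icc.of_isClosed_subset (c2.preimage_isClosed_of_isClosed isClosed_Icc
        isClosed_singleton) inter_subset_left
    obtain ⟨t0, ht0, hm⟩ := hK.exists_isGreatest ⟨0, by simp, by simp [hγ0, pt_2]⟩
    exact ⟨t0, ht0.1, ht0.2, fun t ht he => hm ⟨ht, he⟩⟩
  -- first later time in the bottom plane
  obtain ⟨t1, ht1, ht1e, ht1min⟩ : ∃ t1 ∈ Icc t0 1, γ t1 2 = -ε ∧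
      ∀ t ∈ Icc t0 1, γ t 2 = -ε → t1 ≤ t := by
    have hK : IsCompact (Icc t0 1 ∩ (fun t => γ t 2) ⁻¹' {-ε}) :=
      isCompact_Icc.of_isClosed_subset ((c2.mono (Icc_subset_Icc ht0.1 le_rfl)).preimage_isClosed_of_isClosed
        isClosed_Icc isClosed_singleton) inter_subset_left
    obtain ⟨t0, ht0, hm⟩ := hK.exists_isLeast ⟨1, by simp [ht0.2], by simp [hγ1, pt_2]⟩
    exact ⟨t0, ht0.1, ht0.2, fun t ht he => hm ⟨ht, he⟩⟩
  have hne : t0 ≠ t1 := by rintro rfl; linarith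
  have hlt : t0 < t1 := lt_of_le_of_ne ht1.1 hne
  have hsub : Icc t0 t1 ⊆ Icc (0:ℝ) 1 := Icc_subset_Icc ht0.1 ht1.2
  have hcm : ContinuousOn γ (Icc t0 t1) := hcont.mono hsub
  have hstrict : ∀ t ∈ Ioo t0 t1, -ε < γ t 2 ∧ γ t 2 < ε := by
    intro t ht
    have ht' := hsub (Ioo_subset_Icc_self ht)
    obtain ⟨⟨u1, u2⟩, -⟩ := hU t ht'
    refine ⟨lt_of_le_of_ne u2 ?_, lt_of_le_of_ne u1 ?_⟩
    · intro he
      exact absurd (ht1min t ⟨ht.1.le, ht'.2⟩ he.symm) (not_le.2 ht.2)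
    · intro he
      exact absurd (ht0max t ht' he) (not_le.2 ht.1)
  -- extension of closed conditions to the closed interval
  have ext_le : ∀ f k : ℝ → ℝ, ContinuousOn f (Icc t0 t1) → ContinuousOn k (Icc t0 t1) →
      (∀ t ∈ Ioo t0 t1, f t ≤ k t) → ∀ t ∈ Icc t0 t1, f t ≤ k t := by
    intro f k hf hk hfk t ht
    have hcl : closure (Ioo t0 t1) = Icc t0 t1 := closure_Ioo hne
    rw [← hcl] at ht hf hk
    exact le_on_closure hfk hf hk ht
  have c0m := coord_contOn hcm 0
  have c1m := coord_contOn hcm 1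
  have c2m := coord_contOn hcm 2
  have hpar : ∀ t ∈ Icc t0 t1, γ t 1 ≤ γ t 0 ^ 2 :=
    ext_le _ _ c1m (c0m.pow 2) (fun t ht => frontier_par hε
      (hmaps (hsub (Ioo_subset_Icc_self ht))) (hstrict t ht).1 (hstrict t ht).2)
  have hr : ∀ t ∈ Icc t0 t1, γ t 0 ^ 2 < 1 / 4 := by
    intro t ht
    by_contra hcon
    push Not at hcon
    have ht' := hsub ht
    have d1 := dist_le_len hbv le_rfl ht'.1 ht'.2
    have d2 := dist_le_len hbv ht'.1 ht'.2 le_rfl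
    have d3 := len_add hbv le_rfl ht'.1 ht'.2 le_rfl
    have := far_bound (g := g) hcon (hpar t ht) (d1 := dist (γ 0) (γ t)) (d2 := dist (γ t) (γ 1))
      (by
        rw [e3_dist, hγ0]; simp only [pt_0, pt_1, pt_2]
        apply Real.le_sqrt_of_sq_le
        nlinarith [sq_nonneg (s - γ t 0), sq_nonneg (ε - γ t 2)])
      (by
        rw [e3_dist, hγ1]; simp only [pt_0, pt_1, pt_2]
        apply Real.sqrt_le_sqrt
        nlinarith [sq_nonneg (γ t 2 - -ε)])
    linarith
  have harc : ∀ t ∈ Icc t0 t1, γ t 1 = arc ε (γ t 2) := by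
    have ca := (cont_arc ε).comp_continuousOn c2m
    have hI : ∀ t ∈ Ioo t0 t1, γ t 1 = arc ε (γ t 2) := fun t ht =>
      frontier_arc hε (hmaps (hsub (Ioo_subset_Icc_self ht))) (hstrict t ht).1 (hstrict t ht).2
        (hr t (Ioo_subset_Icc_self ht))
    intro t ht
    exact le_antisymm (ext_le _ _ c1m ca (fun t ht => (hI t ht).le) t ht)
      (ext_le _ _ ca c1m (fun t ht => (hI t ht).ge) t ht)
  -- unrolling
  set θ : ℝ → ℝ := fun t => arcsin (γ t 2 / R) with hθ
  have hθc : ContinuousOn θ (Icc t0 t1) := by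
    apply Real.continuous_arcsin.comp_continuousOn
    exact c2m.div_const R
  have hsq : sin (π / 4) = ε / R := by
    rw [eq_div_iff hRpos.ne', mul_comm]; exact R_sin
  have hθ0 : θ t0 = π / 4 := by
    simp only [hθ, ht0e, ← hsq]
    exact Real.arcsin_sin (by linarith) (by linarith)
  have hθ1 : θ t1 = -(π / 4) := by
    simp only [hθ, ht1e, neg_div, ← hsq, Real.arcsin_neg]
    rw [Real.arcsin_sin (by linarith) (by linarith)]
  have hθb : ∀ t ∈ Icc t0 t1, -(π / 4) ≤ θ t ∧ θ t ≤ π / 4 := by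
    intro t ht
    obtain ⟨⟨u1, u2⟩, -⟩ := hU t (hsub ht)
    rw [← hθ1, ← hθ0]
    constructor
    · apply Real.monotone_arcsin
      rw [ht1e]; exact div_le_div_of_nonneg_right u2 hRpos.le
    · apply Real.monotone_arcsin
      rw [ht0e]; exact div_le_div_of_nonneg_right u1 hRpos.le
  have hsin : ∀ t ∈ Icc t0 t1, R * sin (θ t) = γ t 2 := by
    intro t ht
    obtain ⟨⟨u1, u2⟩, -⟩ := hU t (hsub ht)
    have hs1 : ε / R ≤ 1 := hsq ▸ Real.sin_le_one _
    have v1 : γ t 2 / R ≤ ε / R := div_le_div_of_nonneg_right u1 hRpos.le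
    have v2 : (-ε) / R ≤ γ t 2 / R := div_le_div_of_nonneg_right u2 hRpos.le
    rw [neg_div] at v2
    simp only [hθ]
    rw [Real.sin_arcsin (by linarith) (by linarith)]
    field_simp
  have hγm : ∀ t ∈ Icc t0 t1, γ t = pt (γ t 0) (ε - R * cos (θ t)) (R * sin (θ t)) := by
    intro t ht
    have := arc_sin hε (hθb t ht).1 (hθb t ht).2
    rw [← hR, hsin t ht] at this
    rw [hsin t ht, ← this, ← harc t ht]
    exact e3_eta _
  have hcyl : ∀ a b, t0 ≤ a → a ≤ b → b ≤ t1 →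
      √((R * (θ b - θ a)) ^ 2 + (γ b 0 - γ a 0) ^ 2) ≤ len γ a b := by
    intro a b ha hab hb
    have hI : Icc a b ⊆ Icc t0 t1 := Icc_subset_Icc ha hb
    exact cyl hbv (fun t => γ t 0) θ R ε a b (ht0.1.trans ha) hab (hb.trans ht1.2) (hθc.mono hI)
      (fun t ht => hγm t (hI ht))
  -- lengths of the three parts
  have m0 : t0 ∈ Icc t0 t1 := left_mem_Icc.2 hlt.le
  have m1 : t1 ∈ Icc t0 t1 := right_mem_Icc.2 hlt.le
  have hP1 : γ t0 1 = 0 := by rw [harc t0 m0, ht0e, arc_eps hε]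
  have hQ1 : γ t1 1 = 0 := by rw [harc t1 m1, ht1e, arc_neg, arc_eps hε]
  have ht1' := hsub m1
  have s1 := len_add hbv le_rfl ht0.1 ht0.2 le_rfl
  have s2 := len_add hbv ht0.1 hlt.le ht1.2 le_rfl
  have dA := dist_le_len hbv le_rfl ht0.1 ht0.2
  have dC := dist_le_len hbv ht1'.1 ht1'.2 le_rfl
  have dA' : √((s - γ t0 0) ^ 2 + g ^ 2) ≤ len γ 0 t0 := by
    rw [e3_dist, hγ0] at dA
    simpa only [pt_0, pt_1, pt_2, hP1, ht0e, sub_zero, sub_self, ne_eq, OfNat.ofNat_ne_zero,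
      not_false_eq_true, zero_pow, add_zero] using dA
  have dC' : √(γ t1 0 ^ 2 + (1 / 8) ^ 2) ≤ len γ t1 1 := by
    rw [e3_dist, hγ1] at dC
    simpa only [pt_0, pt_1, pt_2, hQ1, ht1e, sub_zero, zero_sub, neg_sq, sub_self, ne_eq,
      OfNat.ofNat_ne_zero, not_false_eq_true, zero_pow, add_zero] using dC
  have dB' : ∀ t ∈ Icc t0 t1, R * (π / 4 - θ t) ≤ len γ t0 t := by
    intro t ht
    refine le_trans (Real.le_sqrt_of_sq_le ?_) (hcyl t0 t le_rfl ht.1 ht.2)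
    rw [hθ0]
    nlinarith [sq_nonneg (γ t 0 - γ t0 0)]
  have dB := dB' t1 m1
  rw [hθ1] at dB
  have gA : g ≤ √((s - γ t0 0) ^ 2 + g ^ 2) :=
    Real.le_sqrt_of_sq_le (by nlinarith [sq_nonneg (s - γ t0 0)])
  have gC : 1 / 8 ≤ √(γ t1 0 ^ 2 + (1 / 8) ^ 2) :=
    Real.le_sqrt_of_sq_le (by nlinarith [sq_nonneg (γ t1 0)])
  have lA : len γ 0 t0 ≤ g := by linarith
  have lC : len γ t1 1 ≤ 1 / 8 := by linarith
  have lB : len γ t0 t1 ≤ R * (π / 2) := by linarith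
  have hq : γ t1 0 = 0 := by
    have := dC'.trans lC
    rw [Real.sqrt_le_left (by norm_num)] at this
    nlinarith [sq_nonneg (γ t1 0)]
  have hx : ∀ t ∈ Icc t0 t1, γ t 0 = 0 := by
    intro t ht
    have k1 := dB' t ht
    have k2 := hcyl t t1 ht.1 ht.2 le_rfl
    have k3 := len_add hbv ht0.1 ht.1 ht.2 ht1.2
    rw [hθ1, hq] at k2
    have k4 : √((R * (-(π / 4) - θ t)) ^ 2 + (0 - γ t 0) ^ 2) ≤ R * (π / 4 + θ t) := by linarith
    rw [Real.sqrt_le_left ((Real.sqrt_nonneg _).trans k4)] at k4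
    ring_nf at k4
    exact pow_eq_zero_iff (two_ne_zero) |>.1 (le_antisymm (by linarith) (sq_nonneg (γ t 0)))
  have hs0 : s = 0 := by
    have := dA'.trans lA
    rw [Real.sqrt_le_left hg.le, hx t0 m0] at this
    nlinarith [sq_nonneg s]
  have hγt0 : γ t0 = pt 0 0 ε := by
    apply e3_ext <;> simp only [pt_0, pt_1, pt_2]
    exacts [hx t0 m0, hP1, ht0e]
  have hγt1 : γ t1 = pt 0 0 (-ε) := by
    apply e3_ext <;> simp only [pt_0, pt_1, pt_2]
    exacts [hq, hQ1, ht1e]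
  have IA := seg_top hbv le_rfl ht0.1 ht0.2 (hcont.mono (Icc_subset_Icc le_rfl ht0.2)) lA
    (hs0 ▸ hγ0) hγt0
  have IC := seg_bot hbv ht1'.1 ht1'.2 le_rfl (hcont.mono (Icc_subset_Icc ht1'.1 le_rfl)) lC
    hγt1 hγ1
  have IB : γ '' Icc t0 t1 = arcSet ε := by
    apply Subset.antisymm
    · rintro _ ⟨t, ht, rfl⟩
      obtain ⟨⟨u1, u2⟩, -⟩ := hU t (hsub ht)
      refine ⟨γ t 2, ⟨u2, u1⟩, ?_⟩
      apply e3_ext <;> simp only [pt_0, pt_1, pt_2]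
      exacts [hx t ht, harc t ht]
    · rintro _ ⟨y, hy, rfl⟩
      have := intermediate_value_Icc' hlt.le c2m
      simp only [ht0e, ht1e] at this
      obtain ⟨t, ht, hty⟩ := this hy
      simp only at hty
      refine ⟨t, ht, ?_⟩
      apply e3_ext <;> simp only [pt_0, pt_1, pt_2]
      exacts [hx t ht, by rw [harc t ht, hty], hty]
  rw [← IA, ← IB, ← IC, ← image_union, ← image_union, Icc_union_Icc_eq_Icc ht0.1 hlt.le,
    Icc_union_Icc_eq_Icc ht1'.1 ht1'.2]

/-- **Lemma 2 (Bárány–Kuperberg–Zamfirescu).** For `0 < ε < √2/(8π)` and `g > 0`,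
every shortest path on the boundary of `U` joining the line `G` with the focus
`b₁ = (0, 1/8, −ε)` passes through the vertices `v₁ = (0,0,−ε)` and `v₂ = (0,0,ε)`,
and the shortest path is unique (any two length-minimizers have the same image). -/
theorem shortest_path_through_vertices_and_unique
    (ε g : ℝ) (hε0 : 0 < ε) (hε : ε < Real.sqrt 2 / (8 * π)) (hg : 0 < g) :
    (∀ γ : ℝ → E3,
      IsShortestFromSetTo (frontier (bodyU ε)) (lineG g ε) (pt 0 (1 / 8) (-ε)) γ →
        pt 0 0 (-ε) ∈ γ '' Set.Icc 0 1 ∧ pt 0 0 ε ∈ γ '' Set.Icc 0 1) ∧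
    (∀ γ γ' : ℝ → E3,
      IsShortestFromSetTo (frontier (bodyU ε)) (lineG g ε) (pt 0 (1 / 8) (-ε)) γ →
      IsShortestFromSetTo (frontier (bodyU ε)) (lineG g ε) (pt 0 (1 / 8) (-ε)) γ' →
        γ '' Set.Icc 0 1 = γ' '' Set.Icc 0 1) := by
  refine ⟨fun γ h => ?_, fun γ γ' h h' => ?_⟩
  · rw [image_eq hε0 hε hg h]
    exact ⟨Or.inr ⟨0, ⟨le_rfl, by norm_num⟩, rfl⟩, Or.inl (Or.inl ⟨0, ⟨le_rfl, hg.le⟩, rfl⟩)⟩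
  · rw [image_eq hε0 hε hg h, image_eq hε0 hε hg h']
end
end

section
/- For every natural number n there exist a convex polytope Q ⊆ ℝ³ (the convex hull of a finite set) with nonempty interior, real numbers h₁ < h₂ such that the points a = (0, 0, h₁) and b = (0, 0, h₂) lie in frontier Q, a continuous path γ : [0,1] → frontier Q with γ(0) = a and γ(1) = b which is a shortest path from a to b on frontier Q (its length equals the infimum of the lengths of all continuous paths in frontier Q from a to b), and continuous functions φ : (0,1) → ℝ and ρ : (0,1) → ℝ with ρ(t) > 0 and γ(t) = (ρ(t)·cos φ(t), ρ(t)·sin φ(t), γ(t)₃) for all t ∈ (0,1), such that |φ(s) − φ(t)| ≥ 2πn for some s, t ∈ (0,1). In other words, the shortest path γ spirals at least n times around the line through a and b. -/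
open scoped ENNReal
open Real Set

noncomputable section

/-- The infimum of the lengths of all continuous paths in `S` from `a` to `b`. -/
def geodesicDist (S : Set E3) (a b : E3) : ℝ≥0∞ :=
  sInf {L | ∃ γ : ℝ → E3, ContinuousOn γ (Set.Icc 0 1) ∧
    Set.MapsTo γ (Set.Icc 0 1) S ∧ γ 0 = a ∧ γ 1 = b ∧ L = pathLength γ}

/-- `f` restricted to `[0,1]` is a `V`-Lipschitz path from `a` to `b` inside `S`. -/
def LipPath (S : Set E3) (a b : E3) (V : ℝ) (f : ℝ → E3) : Prop :=
  f 0 = a ∧ f 1 = b ∧ (∀ t ∈ Icc (0 : ℝ) 1, f t ∈ S) ∧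
    ∀ s ∈ Icc (0 : ℝ) 1, ∀ t ∈ Icc (0 : ℝ) 1, dist (f s) (f t) ≤ V * |s - t|

lemma dist_le_of_open {X : Type*} [MetricSpace X] {γ : ℝ → X} {α β A B C : ℝ} (hγ : ContinuousOn γ (Icc α β))
    (hA : A ∈ Icc α β) (hB : B ∈ Icc α β) (hAB : A < B)
    (h : ∀ t₁ t₂, A < t₁ → t₁ < t₂ → t₂ < B → dist (γ t₁) (γ t₂) ≤ C) :
    dist (γ A) (γ B) ≤ C := by
  have hcont : ContinuousOn (fun η : ℝ => dist (γ (A + η * (B - A))) (γ (B - η * (B - A))))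
      (Icc 0 1) := by
    refine continuous_dist.comp_continuousOn (ContinuousOn.prodMk ?_ ?_)
    · refine hγ.comp (by fun_prop) ?_
      intro η hη
      have e1 := mul_nonneg hη.1 (sub_nonneg.mpr hAB.le)
      have e2 := mul_le_mul_of_nonneg_right hη.2 (sub_nonneg.mpr hAB.le)
      constructor <;> linarith [hA.1, hB.2]
    · refine hγ.comp (by fun_prop) ?_
      intro η hη
      have e1 := mul_nonneg hη.1 (sub_nonneg.mpr hAB.le)
      have e2 := mul_le_mul_of_nonneg_right hη.2 (sub_nonneg.mpr hAB.le)
      constructor <;> linarith [hA.1, hB.2]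
  have h0 : Filter.Tendsto (fun η : ℝ => dist (γ (A + η * (B - A))) (γ (B - η * (B - A))))
      (nhdsWithin 0 (Ioo 0 (1/2))) (nhds (dist (γ A) (γ B))) := by
    have hsub : Ioo (0:ℝ) (1/2) ⊆ Icc 0 1 := by
      intro x hx
      exact ⟨hx.1.le, by linarith [hx.2]⟩
    have h1 := (hcont 0 ⟨le_rfl, zero_le_one⟩).mono hsub
    have h2 := h1.tendsto
    simp only [zero_mul, add_zero, sub_zero] at h2
    exact h2
  have hne : (nhdsWithin (0:ℝ) (Ioo 0 (1/2))).NeBot := by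
    apply mem_closure_iff_nhdsWithin_neBot.mp
    rw [closure_Ioo (by norm_num)]
    simp
  refine le_of_tendsto h0 ?_
  filter_upwards [self_mem_nhdsWithin] with η hη
  have h1 := hη.1
  have h2 := hη.2
  have h3 : 0 < B - A := by linarith
  have h4 : 0 < η * (B - A) := mul_pos h1 h3
  have h5 : η * (B - A) < 1 / 2 * (B - A) := mul_lt_mul_of_pos_right h2 h3
  apply h <;> linarith

lemma reparam {γ : ℝ → E3} {v : ℝ → ℝ} {α β V : ℝ} (hαβ : α ≤ β)
    (hγ : ContinuousOn γ (Icc α β))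
    (hv : ∀ s ∈ Icc α β, ∀ t ∈ Icc α β, s ≤ t → dist (γ s) (γ t) ≤ v t - v s)
    (hα : v α = 0) (hβ : v β ≤ V) {S : Set E3} (hS : ∀ t ∈ Icc α β, γ t ∈ S) :
    ∃ f, LipPath S (γ α) (γ β) V f := by
  have hmono : ∀ s ∈ Icc α β, ∀ t ∈ Icc α β, s ≤ t → v s ≤ v t := fun s hs t ht hst => by
    linarith [hv s hs t ht hst, dist_nonneg (x := γ s) (y := γ t)]
  have hαm : α ∈ Icc α β := ⟨le_rfl, hαβ⟩
  have hβm : β ∈ Icc α β := ⟨hαβ, le_rfl⟩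
  have hV : 0 ≤ V := by linarith [hmono α hαm β hβm hαβ]
  let T : ℝ → Set ℝ := fun s => {t | t ∈ Icc α β ∧ v t ≤ V * s}
  have hne : ∀ s, 0 ≤ s → (T s).Nonempty := fun s hs => ⟨α, hαm, by rw [hα]; positivity⟩
  have hbd : ∀ s, BddAbove (T s) := fun s => ⟨β, fun t ht => ht.1.2⟩
  let g : ℝ → ℝ := fun s => sSup (T s)
  have hg : ∀ s, 0 ≤ s → g s ∈ Icc α β := fun s hs =>
    ⟨le_csSup (hbd s) ⟨hαm, by rw [hα]; positivity⟩, csSup_le (hne s hs) fun t ht => ht.1.2⟩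
  have P1 : ∀ s, ∀ t ∈ Icc α β, g s < t → V * s < v t := by
    intro s t ht hst
    by_contra hcon
    exact absurd (le_csSup (hbd s) ⟨ht, not_lt.mp hcon⟩) (not_le.mpr hst)
  have P2 : ∀ s, 0 ≤ s → ∀ t ∈ Icc α β, t < g s → v t ≤ V * s := by
    intro s hs t ht hst
    obtain ⟨t', ht', h⟩ := exists_lt_of_lt_csSup (hne s hs) hst
    exact (hmono t ht t' ht'.1 h.le).trans ht'.2
  have gmono : ∀ s s', 0 ≤ s → s ≤ s' → g s ≤ g s' := by
    intro s s' hs hss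
    apply csSup_le_csSup (hbd s') (hne s hs)
    intro t ht
    exact ⟨ht.1, ht.2.trans (by gcongr)⟩
  have key : ∀ s s', 0 ≤ s → s ≤ s' → dist (γ (g s)) (γ (g s')) ≤ V * (s' - s) := by
    intro s s' hs hss
    have hs' := hs.trans hss
    rcases (gmono s s' hs hss).eq_or_lt with h | h
    · rw [h, dist_self]
      exact mul_nonneg hV (by linarith)
    · apply dist_le_of_open hγ (hg s hs) (hg s' hs') h
      intro t₁ t₂ h1 h12 h2
      have m1 : t₁ ∈ Icc α β := ⟨by linarith [(hg s hs).1], by linarith [(hg s' hs').2]⟩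
      have m2 : t₂ ∈ Icc α β := ⟨by linarith [(hg s hs).1], by linarith [(hg s' hs').2]⟩
      have := hv _ m1 _ m2 h12.le
      have := P1 s _ m1 h1
      have := P2 s' hs' _ m2 h2
      linarith
  refine ⟨fun s => γ (g s), ?_, ?_, ?_, ?_⟩
  · have h0 := hg 0 le_rfl
    rcases h0.1.eq_or_lt with h | h
    · simp only; rw [← h]
    · have : dist (γ α) (γ (g 0)) ≤ 0 := by
        apply dist_le_of_open hγ hαm h0 h
        intro t₁ t₂ h1 h12 h2
        have m1 : t₁ ∈ Icc α β := ⟨by linarith, by linarith [h0.2]⟩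
        have m2 : t₂ ∈ Icc α β := ⟨by linarith, by linarith [h0.2]⟩
        have := hv _ m1 _ m2 h12.le
        have := P2 0 le_rfl _ m2 h2
        have := hmono _ hαm _ m1 m1.1
        linarith
      exact (dist_le_zero.mp this).symm
  · have : g 1 = β := le_antisymm (hg 1 zero_le_one).2
      (le_csSup (hbd 1) ⟨hβm, by linarith⟩)
    simp only [this]
  · intro t ht
    exact hS _ (hg t ht.1)
  · intro s hs t ht
    rcases le_total s t with h | h
    · rw [abs_sub_comm, abs_of_nonneg (by linarith)]
      exact key s t hs.1 h
    · rw [abs_of_nonneg (by linarith), dist_comm]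
      exact key t s ht.1 h

lemma LipPath.nonneg {S a b V f} (h : LipPath S a b V f) : 0 ≤ V := by
  have := h.2.2.2 0 (by simp) 1 (by simp)
  have h2 := dist_nonneg (x := f 0) (y := f 1)
  simp at this
  linarith

lemma LipPath.lip {S a b V f} (h : LipPath S a b V f) :
    LipschitzOnWith V.toNNReal f (Icc 0 1) := by
  apply LipschitzOnWith.of_dist_le_mul
  intro x hx y hy
  rw [Real.coe_toNNReal _ h.nonneg, Real.dist_eq]
  exact h.2.2.2 x hx y hy

lemma LipPath.continuousOn {S a b V f} (h : LipPath S a b V f) : ContinuousOn f (Icc 0 1) :=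
  h.lip.continuousOn

lemma LipPath.pathLength_le {S a b V f} (h : LipPath S a b V f) :
    pathLength f ≤ ENNReal.ofReal V := by
  have := h.lip.comp_eVariationOn_le (g := id) (s := Icc (0:ℝ) 1) (fun x hx => hx)
  have h2 := (monotone_id.monotoneOn (Icc (0:ℝ) 1)).eVariationOn_eq
    (a := 0) (b := 1) (by simp) (by simp)
  simp only [Function.comp_id, inter_self] at this h2
  refine this.trans ?_
  refine (mul_le_mul_right h2.le _).trans ?_
  simp [ENNReal.ofReal]

lemma exists_lipPath {S : Set E3} {γ : ℝ → E3} (hγ : ContinuousOn γ (Icc 0 1))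
    (hS : ∀ t ∈ Icc (0 : ℝ) 1, γ t ∈ S) (hfin : pathLength γ ≠ ⊤) :
    ∃ f, LipPath S (γ 0) (γ 1) (pathLength γ).toReal f := by
  have hfin' : ∀ t ≤ (1:ℝ), eVariationOn γ (Icc 0 t) ≠ ⊤ := fun t ht =>
    ne_top_of_le_ne_top hfin (eVariationOn.mono γ (Icc_subset_Icc_right ht))
  apply reparam (v := fun t => (eVariationOn γ (Icc 0 t)).toReal) zero_le_one hγ _ _ _ hS
  · intro s hs t ht hst
    have h1 := eVariationOn.Icc_add_Icc γ (s := univ) hs.1 hst (mem_univ s)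
    simp only [univ_inter] at h1
    have h3 : eVariationOn γ (Icc s t) ≠ ⊤ :=
      ne_top_of_le_ne_top hfin (eVariationOn.mono γ (Icc_subset_Icc hs.1 ht.2))
    have h2 := eVariationOn.edist_le γ (s := Icc s t) (x := s) (y := t) ⟨le_rfl, hst⟩ ⟨hst, le_rfl⟩
    rw [← h1, ENNReal.toReal_add (hfin' s hs.2) h3]
    rw [edist_dist] at h2
    have := (ENNReal.ofReal_le_iff_le_toReal h3).mp h2
    linarith
  · simp [eVariationOn.subsingleton]
  · exact le_rfl

lemma exists_shortest {K : Set E3} (hK : IsCompact K) {a b : E3} {V₀ : ℝ} {f₀ : ℝ → E3}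
    (h₀ : LipPath K a b V₀ f₀) :
    ∃ f ℓ, LipPath K a b ℓ f ∧ pathLength f = geodesicDist K a b ∧
      ∀ V g, LipPath K a b V g → ℓ ≤ V := by
  let S : Set ℝ := {V | ∃ g, LipPath K a b V g}
  have hSne : S.Nonempty := ⟨V₀, f₀, h₀⟩
  have hSb : BddBelow S := ⟨0, fun V ⟨g, hg⟩ => hg.nonneg⟩
  let ℓ := sInf S
  have hmin : ∀ V g, LipPath K a b V g → ℓ ≤ V := fun V g hg => csInf_le hSb ⟨g, hg⟩
  -- compactness
  let Z : {V : ℝ // ℓ < V} → Set (ℝ → E3) := fun V =>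
    {f | LipPath K a b V f ∧ ∀ t, f t ∈ K}
  have hclosed : ∀ V, IsClosed (Z V) := by
    intro V
    have : Z V = {f | f 0 = a} ∩ {f | f 1 = b} ∩ (⋂ t ∈ Icc (0:ℝ) 1, {f | f t ∈ K}) ∩
      (⋂ s ∈ Icc (0:ℝ) 1, ⋂ t ∈ Icc (0:ℝ) 1, {f | dist (f s) (f t) ≤ V * |s - t|}) ∩
      ⋂ t, {f | f t ∈ K} := by
      ext f
      simp only [Z, LipPath, mem_ofPred_eq, mem_inter_iff, mem_iInter]
      tauto
    rw [this]
    refine IsClosed.inter (IsClosed.inter (IsClosed.inter (IsClosed.inter ?_ ?_) ?_) ?_) ?_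
    · exact isClosed_eq (continuous_apply _) continuous_const
    · exact isClosed_eq (continuous_apply _) continuous_const
    · exact isClosed_biInter fun t _ => hK.isClosed.preimage (continuous_apply t)
    · exact isClosed_biInter fun s _ => isClosed_biInter fun t _ =>
        isClosed_le ((continuous_apply s).dist (continuous_apply t)) continuous_const
    · exact isClosed_iInter fun t => hK.isClosed.preimage (continuous_apply t)
  have hcpt : ∀ V, IsCompact (Z V) := by
    intro V
    refine (isCompact_univ_pi (fun _ : ℝ => hK)).of_isClosed_subset (hclosed V) ?_
    intro f hf t _
    exact hf.2 t
  have hne : ∀ V, (Z V).Nonempty := by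
    rintro ⟨V, hV⟩
    obtain ⟨W, ⟨g, hg⟩, hW⟩ := exists_lt_of_csInf_lt hSne hV
    refine ⟨fun t => g (max 0 (min t 1)), ⟨?_, ?_, ?_, ?_⟩, ?_⟩
    · simp [hg.1]
    · simp [hg.2.1]
    · intro t ht
      simp [ht.1, ht.2, hg.2.2.1 t ht]
    · intro s hs t ht
      simp only [ht.1, ht.2, hs.1, hs.2, inf_of_le_left, sup_of_le_right]
      refine (hg.2.2.2 s hs t ht).trans ?_
      gcongr
    · intro t
      exact hg.2.2.1 _ ⟨le_max_left _ _, max_le zero_le_one (min_le_right _ _)⟩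
  have : Nonempty {V : ℝ // ℓ < V} := ⟨ℓ + 1, by linarith⟩
  obtain ⟨f, hf⟩ := IsCompact.nonempty_iInter_of_directed_nonempty_isCompact_isClosed Z
    (by
      rintro ⟨V, hV⟩ ⟨W, hW⟩
      refine ⟨⟨min V W, lt_min hV hW⟩, ?_, ?_⟩
      · rintro f ⟨⟨h1, h2, h3, h4⟩, h5⟩
        exact ⟨⟨h1, h2, h3, fun s hs t ht => (h4 s hs t ht).trans
          (mul_le_mul_of_nonneg_right (min_le_left _ _) (abs_nonneg _))⟩, h5⟩
      · rintro f ⟨⟨h1, h2, h3, h4⟩, h5⟩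
        exact ⟨⟨h1, h2, h3, fun s hs t ht => (h4 s hs t ht).trans
          (mul_le_mul_of_nonneg_right (min_le_right _ _) (abs_nonneg _))⟩, h5⟩)
    hne hcpt hclosed
  rw [mem_iInter] at hf
  have hfl : LipPath K a b ℓ f := by
    obtain ⟨h1, h2, h3, _⟩ := (hf ⟨ℓ + 1, by linarith⟩).1
    refine ⟨h1, h2, h3, fun s hs t ht => ?_⟩
    apply le_of_forall_pos_le_add
    intro ε hε
    have h4 := (hf ⟨ℓ + ε, by linarith⟩).1.2.2.2 s hs t ht
    have : |s - t| ≤ 1 := by rw [abs_le]; constructor <;> linarith [hs.1, hs.2, ht.1, ht.2]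
    simp only at h4
    nlinarith
  refine ⟨f, ℓ, hfl, ?_, hmin⟩
  apply le_antisymm
  · refine hfl.pathLength_le.trans ?_
    apply le_sInf
    rintro L ⟨γ, hγ, hm, rfl, rfl, rfl⟩
    by_cases hfin : pathLength γ = ⊤
    · simp [hfin]
    · obtain ⟨g, hg⟩ := exists_lipPath hγ hm hfin
      exact (ENNReal.ofReal_le_iff_le_toReal hfin).mpr (hmin _ _ hg)
  · exact sInf_le ⟨f, hfl.continuousOn, hfl.2.2.1, hfl.1, hfl.2.1, rfl⟩

lemma LipPath.trans {S : Set E3} {a b c : E3} {V W : ℝ} {f g : ℝ → E3}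
    (hf : LipPath S a b V f) (hg : LipPath S b c W g) : ∃ h, LipPath S a c (V + W) h := by
  have hV := hf.nonneg
  have hW := hg.nonneg
  let γ : ℝ → E3 := fun t => if t ≤ 1 then f t else g (t - 1)
  let v : ℝ → ℝ := fun t => if t ≤ 1 then V * t else V + W * (t - 1)
  have hd : ∀ s ∈ Icc (0:ℝ) 2, ∀ t ∈ Icc (0:ℝ) 2, s ≤ t →
      dist (γ s) (γ t) ≤ v t - v s := by
    intro s hs t ht hst
    simp only [γ, v]
    by_cases h1 : t ≤ 1
    · have h2 : s ≤ 1 := hst.trans h1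
      simp only [h1, h2, if_true]
      have := hf.2.2.2 s ⟨hs.1, h2⟩ t ⟨ht.1, h1⟩
      rw [abs_sub_comm, abs_of_nonneg (by linarith)] at this
      linarith
    · have gm : t - 1 ∈ Icc (0:ℝ) 1 := ⟨by linarith, by linarith [ht.2]⟩
      by_cases h2 : s ≤ 1
      · simp only [h1, h2, if_true, if_false]
        have e1 := hf.2.2.2 s ⟨hs.1, h2⟩ 1 (by simp)
        have e2 := hg.2.2.2 0 (by simp) (t-1) gm
        rw [abs_sub_comm, abs_of_nonneg (by linarith)] at e1 e2
        rw [hf.2.1] at e1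
        rw [hg.1] at e2
        have := dist_triangle (f s) b (g (t-1))
        linarith
      · simp only [h1, h2, if_false]
        have e2 := hg.2.2.2 (s-1) ⟨by linarith, by linarith [hs.2]⟩ (t-1) gm
        rw [abs_sub_comm, abs_of_nonneg (by linarith)] at e2
        linarith
  have hlip : ∀ s ∈ Icc (0:ℝ) 2, ∀ t ∈ Icc (0:ℝ) 2, s ≤ t →
      v t - v s ≤ (V + W) * (t - s) := by
    intro s hs t ht hst
    simp only [v]
    split_ifs <;> nlinarith
  have hc : ContinuousOn γ (Icc 0 2) := by
    have : LipschitzOnWith (V + W).toNNReal γ (Icc 0 2) := by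
      apply LipschitzOnWith.of_dist_le_mul
      intro x hx y hy
      rw [Real.coe_toNNReal _ (by linarith), Real.dist_eq]
      rcases le_total x y with h | h
      · rw [abs_sub_comm, abs_of_nonneg (by linarith)]
        exact (hd x hx y hy h).trans (hlip x hx y hy h)
      · rw [abs_of_nonneg (by linarith), dist_comm]
        exact (hd y hy x hx h).trans (hlip y hy x hx h)
    exact this.continuousOn
  have := reparam (S := S) (V := V + W) zero_le_two hc hd (by simp [v])
    (by simp [v]; norm_num) (by
      intro t ht
      simp only [γ]
      split_ifs with h
      · exact hf.2.2.1 t ⟨ht.1, h⟩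
      · exact hg.2.2.1 _ ⟨by linarith, by linarith [ht.2]⟩)
  have e0 : γ 0 = a := by simp [γ, hf.1]
  have e2 : γ 2 = c := by
    have : (2:ℝ) - 1 = 1 := by norm_num
    simp [γ, this, hg.2.1]
  rwa [e0, e2] at this

lemma lipPath_segment {S : Set E3} {a b : E3}
    (h : ∀ r ∈ Icc (0:ℝ) 1, a + r • (b - a) ∈ S) :
    LipPath S a b (dist a b) (fun r => a + r • (b - a)) := by
  refine ⟨by simp, by simp, h, ?_⟩
  intro s _ t _
  rw [dist_add_left, dist_eq_norm, ← sub_smul, norm_smul, dist_comm a b, dist_eq_norm,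
    Real.norm_eq_abs, mul_comm]

lemma LipPath.ne_left {K : Set E3} {a b : E3} {ℓ : ℝ} {f : ℝ → E3} (hab : a ≠ b)
    (hf : LipPath K a b ℓ f) (hmin : ∀ V g, LipPath K a b V g → ℓ ≤ V) {t : ℝ}
    (ht : t ∈ Ioo (0:ℝ) 1) : f t ≠ a ∧ f t ≠ b := by
  have hℓ : 0 < ℓ := by
    rcases hf.nonneg.eq_or_lt with h | h
    · exfalso
      have := hf.2.2.2 0 (by simp) 1 (by simp)
      rw [hf.1, hf.2.1, ← h, zero_mul] at this
      exact hab (dist_le_zero.mp this)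
    · exact h
  constructor
  · intro h
    have : LipPath K a b (ℓ * (1 - t)) (fun s => f (t + s * (1 - t))) := by
      have hm : ∀ s ∈ Icc (0:ℝ) 1, t + s * (1 - t) ∈ Icc (0:ℝ) 1 := fun s hs =>
        ⟨by nlinarith [hs.1, ht.1, ht.2], by nlinarith [hs.2, ht.2]⟩
      refine ⟨by simp [h], by simp [hf.2.1], fun s hs => hf.2.2.1 _ (hm s hs), ?_⟩
      intro s hs s' hs'
      refine (hf.2.2.2 _ (hm s hs) _ (hm s' hs')).trans (le_of_eq ?_)
      rw [show t + s * (1 - t) - (t + s' * (1 - t)) = (1 - t) * (s - s') by ring, abs_mul,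
        abs_of_pos (by linarith [ht.2])]
      ring
    have := hmin _ _ this
    nlinarith [ht.1]
  · intro h
    have : LipPath K a b (ℓ * t) (fun s => f (t * s)) := by
      have hm : ∀ s ∈ Icc (0:ℝ) 1, t * s ∈ Icc (0:ℝ) 1 := fun s hs =>
        ⟨by nlinarith [hs.1, ht.1, ht.2], by nlinarith [hs.1, hs.2, ht.2]⟩
      refine ⟨by simp [hf.1], by simp [h], fun s hs => hf.2.2.1 _ (hm s hs), ?_⟩
      intro s hs s' hs'
      refine (hf.2.2.2 _ (hm s hs) _ (hm s' hs')).trans (le_of_eq ?_)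
      rw [show t * s - t * s' = t * (s - s') by ring, abs_mul, abs_of_pos ht.1]
      ring
    have := hmin _ _ this
    nlinarith [ht.2]

lemma LipPath.project {Q : Set E3} (hQ : Convex ℝ Q) (hQc : IsCompact Q) {a b : E3} {V : ℝ}
    {f : ℝ → E3} (ha : a ∈ Q) (hb : b ∈ Q) (hf : LipPath (interior Q)ᶜ a b V f) :
    ∃ g, LipPath (frontier Q) a b V g := by
  have hex : ∀ x : E3, ∃ p ∈ Q, ∀ w ∈ Q, inner ℝ (x - p) (w - p) ≤ (0:ℝ) := by
    intro x
    obtain ⟨p, hp, h⟩ := exists_norm_eq_iInf_of_complete_convex ⟨a, ha⟩ hQc.isComplete hQ x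
    exact ⟨p, hp, (norm_eq_iInf_iff_real_inner_le_zero hQ hp).mp h⟩
  choose P hP hin using hex
  have hself : ∀ x ∈ Q, P x = x := by
    intro x hx
    have h := hin x x hx
    rw [real_inner_self_eq_norm_sq] at h
    have : ‖x - P x‖ = 0 := by nlinarith [norm_nonneg (x - P x)]
    exact (sub_eq_zero.mp (norm_eq_zero.mp this)).symm
  have hlip : ∀ x y, dist (P x) (P y) ≤ dist x y := by
    intro x y
    have h1 := hin x (P y) (hP y)
    have h2 := hin y (P x) (hP x)
    have h3 : ‖P x - P y‖ ^ 2 ≤ inner ℝ (x - y) (P x - P y) := by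
      rw [← real_inner_self_eq_norm_sq]
      have e : inner ℝ (x - y) (P x - P y) - inner ℝ (P x - P y) (P x - P y)
          = - inner ℝ (x - P x) (P y - P x) - inner ℝ (y - P y) (P x - P y) := by
        simp only [inner_sub_left, inner_sub_right]
        ring
      linarith
    have h4 := real_inner_le_norm (x - y) (P x - P y)
    rw [dist_eq_norm, dist_eq_norm]
    by_contra hcon
    push Not at hcon
    nlinarith [norm_nonneg (P x - P y), norm_nonneg (x - y)]
  have hfr : ∀ x, x ∉ interior Q → P x ∈ frontier Q := by
    intro x hx
    refine ⟨subset_closure (hP x), fun hint => ?_⟩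
    have hc : Filter.Tendsto (fun r : ℝ => P x + r • (x - P x)) (nhdsWithin 0 (Ioi 0))
        (nhds (P x)) := by
      have : Continuous (fun r : ℝ => P x + r • (x - P x)) := by fun_prop
      have h := this.tendsto 0
      simp only [zero_smul, add_zero] at h
      exact h.mono_left nhdsWithin_le_nhds
    have hev := hc.eventually (mem_interior_iff_mem_nhds.mp hint)
    obtain ⟨r, hr, hr0⟩ := (hev.and self_mem_nhdsWithin).exists
    have h := hin x _ hr
    rw [add_sub_cancel_left, inner_smul_right, real_inner_self_eq_norm_sq] at h
    have hr0 : 0 < r := hr0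
    have h5 : ‖x - P x‖ ^ 2 ≤ 0 := by
      by_contra hcon
      push Not at hcon
      nlinarith [mul_pos hr0 hcon]
    have : ‖x - P x‖ = 0 := by nlinarith [norm_nonneg (x - P x)]
    have := (sub_eq_zero.mp (norm_eq_zero.mp this)).symm
    rw [this] at hint
    exact hx hint
  refine ⟨fun t => P (f t), ?_, ?_, ?_, ?_⟩
  · simp only [hf.1, hself a ha]
  · simp only [hf.2.1, hself b hb]
  · intro t ht
    exact hfr _ (hf.2.2.1 t ht)
  · intro s hs t ht
    exact (hlip _ _).trans (hf.2.2.2 s hs t ht)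

@[simp] lemma pt_zero (a b c : ℝ) : pt a b c 0 = a := by simp [pt]
@[simp] lemma pt_one (a b c : ℝ) : pt a b c 1 = b := by simp [pt]
@[simp] lemma pt_two (a b c : ℝ) : pt a b c 2 = c := by simp [pt]

lemma dist_sq_E3 (x y : E3) :
    dist x y ^ 2 = (x 0 - y 0) ^ 2 + (x 1 - y 1) ^ 2 + (x 2 - y 2) ^ 2 := by
  rw [EuclideanSpace.dist_eq, Real.sq_sqrt (by positivity), Fin.sum_univ_three]
  simp [Real.dist_eq, sq_abs]

lemma abs_coord_le (x y : E3) (i : Fin 3) : |x i - y i| ≤ dist x y := by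
  apply abs_le_of_sq_le_sq _ dist_nonneg
  rw [dist_sq_E3]
  fin_cases i <;> simp <;> nlinarith [sq_nonneg (x 0 - y 0), sq_nonneg (x 1 - y 1),
    sq_nonneg (x 2 - y 2)]

lemma E3_ext {x y : E3} (h0 : x 0 = y 0) (h1 : x 1 = y 1) (h2 : x 2 = y 2) : x = y := by
  ext i
  fin_cases i
  · exact h0
  · exact h1
  · exact h2

/-- The horizontal coordinate orthogonal to the direction of angle `θ`. -/
def NN (θ : ℝ) (x : E3) : ℝ := -Real.sin θ * x 0 + Real.cos θ * x 1

/-- A wedge (or slab): the basic convex constraint. -/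
def Wedge (θ α β : ℝ) : Set E3 := {x | |NN θ x| ≤ α + β * x 2}

lemma convex_wedge (θ α β : ℝ) : Convex ℝ (Wedge θ α β) := by
  intro x hx y hy a b ha hb hab
  simp only [Wedge, mem_ofPred_eq, abs_le] at hx hy ⊢
  have e : NN θ (a • x + b • y) = a * NN θ x + b * NN θ y := by
    simp [NN]; ring
  have e2 : (a • x + b • y) 2 = a * x 2 + b * y 2 := by simp
  have e3 : α = a * α + b * α := by rw [← add_mul, hab, one_mul]
  rw [e, e2]
  have h1 := mul_le_mul_of_nonneg_left hx.1 ha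
  have h2 := mul_le_mul_of_nonneg_left hx.2 ha
  have h3 := mul_le_mul_of_nonneg_left hy.1 hb
  have h4 := mul_le_mul_of_nonneg_left hy.2 hb
  constructor <;> linarith

lemma not_mem_interior_of_wedge {Q : Set E3} {θ α β : ℝ} (hQ : Q ⊆ Wedge θ α β) {x : E3}
    (hx : NN θ x = α + β * x 2) : x ∈ (interior Q)ᶜ := by
  intro hint
  have hc : Filter.Tendsto (fun r : ℝ => x + r • pt (-Real.sin θ) (Real.cos θ) 0)
      (nhdsWithin 0 (Ioi 0)) (nhds x) := by
    have : Continuous (fun r : ℝ => x + r • pt (-Real.sin θ) (Real.cos θ) 0) := by fun_prop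
    have h := this.tendsto 0
    simp only [zero_smul, add_zero] at h
    exact h.mono_left nhdsWithin_le_nhds
  have hev := hc.eventually (mem_interior_iff_mem_nhds.mp hint)
  obtain ⟨r, hr, hr0⟩ := (hev.and self_mem_nhdsWithin).exists
  have hr0 : 0 < r := hr0
  have h' : |NN θ (x + r • pt (-Real.sin θ) (Real.cos θ) 0)| ≤
      α + β * (x + r • pt (-Real.sin θ) (Real.cos θ) 0) 2 := hQ hr
  have h := (abs_le.mp h').2
  have e : NN θ (x + r • pt (-Real.sin θ) (Real.cos θ) 0) = NN θ x + r := by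
    have := Real.sin_sq_add_cos_sq θ
    simp only [NN, PiLp.add_apply, PiLp.smul_apply, pt_zero, pt_one, smul_eq_mul]
    linear_combination r * this
  rw [e] at h
  simp at h
  linarith

lemma ball_subset_wedge {θ α β η : ℝ} {x : E3} (hβ : |β| ≤ 1)
    (h : |NN θ x| + η ≤ α + β * x 2) : Metric.ball x (η / 3) ⊆ Wedge θ α β := by
  intro y hy
  have hy : dist y x < η / 3 := hy
  have h0 := abs_coord_le y x 0
  have h1 := abs_coord_le y x 1
  have h2 := abs_coord_le y x 2
  have e0 : |NN θ y - NN θ x| ≤ 2 * dist y x := by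
    have : NN θ y - NN θ x = -Real.sin θ * (y 0 - x 0) + Real.cos θ * (y 1 - x 1) := by
      simp only [NN]; ring
    rw [this]
    refine (abs_add_le _ _).trans ?_
    rw [abs_mul, abs_mul, abs_neg]
    have := mul_le_mul (Real.abs_sin_le_one θ) h0 (abs_nonneg _) zero_le_one
    have := mul_le_mul (Real.abs_cos_le_one θ) h1 (abs_nonneg _) zero_le_one
    linarith
  have e1 : |β * (y 2 - x 2)| ≤ dist y x := by
    rw [abs_mul]
    have := mul_le_mul hβ h2 (abs_nonneg _) zero_le_one
    linarith
  have e2 := (abs_le.mp e1).1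
  have e3 := abs_sub_abs_le_abs_sub (NN θ y) (NN θ x)
  show |NN θ y| ≤ α + β * y 2
  linarith

/-- The convex body: all constraints. -/
def Body (c U : ℝ) : Set E3 :=
  Wedge 0 0 (2 * c) ∩
  Wedge (c * U) (4 * c * exp (U / 2)) (-(2 * c * exp (-(U / 2)))) ∩
  ⋂ v ∈ Icc 0 U, Wedge (c * v) (c * exp (v / 2)) (c * exp (-(v / 2)))

lemma convex_body (c U : ℝ) : Convex ℝ (Body c U) :=
  ((convex_wedge _ _ _).inter (convex_wedge _ _ _)).inter
    (convex_iInter₂ fun _ _ => convex_wedge _ _ _)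

lemma exp_half_sq (u : ℝ) : exp u = exp (u / 2) * exp (u / 2) := by
  rw [← Real.exp_add]; congr 1; ring

lemma helicoid_mem_interior {c U u s : ℝ} (hc : 0 < c) (hc1 : 2 * c ≤ 1)
    (hu : u ∈ Icc 0 U) (hs : |s| ≤ exp (u / 2)) :
    pt (s * Real.cos (c * u)) (s * Real.sin (c * u)) (exp u) ∈ interior (Body c U) := by
  set x := pt (s * Real.cos (c * u)) (s * Real.sin (c * u)) (exp u) with hx
  have hA1 : 1 ≤ exp (u / 2) := Real.one_le_exp (by linarith [hu.1])
  have hN : ∀ v, |NN (c * v) x| ≤ exp (u / 2) * (c * |u - v|) := by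
    intro v
    have : NN (c * v) x = s * Real.sin (c * (u - v)) := by
      rw [mul_sub, Real.sin_sub]
      simp only [NN, hx, pt_zero, pt_one]
      ring
    rw [this, abs_mul]
    refine mul_le_mul hs ?_ (abs_nonneg _) (by positivity)
    refine Real.abs_sin_le_abs.trans ?_
    rw [abs_mul, abs_of_pos hc]
  have hx2 : x 2 = exp u := by simp [hx]
  have hU : 0 ≤ U := hu.1.trans hu.2
  have hinv : ∀ w : ℝ, 0 ≤ w → exp (-(w / 2)) ≤ 1 := fun w hw => Real.exp_le_one_iff.mpr (by linarith)
  have b1 : Metric.ball x (c / 3) ⊆ Wedge 0 0 (2 * c) := by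
    apply ball_subset_wedge
    · rw [abs_of_pos (by positivity)]; exact hc1
    · have h := hN 0
      rw [mul_zero, sub_zero, abs_of_nonneg hu.1] at h
      rw [hx2, exp_half_sq u]
      have h2 := Real.add_one_le_exp (u / 2)
      have : 0 ≤ c * (exp (u/2) * (2 * exp (u/2) - u - 1) - 1) := by
        apply mul_nonneg hc.le
        nlinarith
      nlinarith
  have b2 : Metric.ball x (c / 3) ⊆
      Wedge (c * U) (4 * c * exp (U / 2)) (-(2 * c * exp (-(U / 2)))) := by
    apply ball_subset_wedge
    · rw [abs_neg, abs_of_pos (by positivity)]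
      have := hinv U hU
      nlinarith
    · have h := hN U
      rw [abs_sub_comm, abs_of_nonneg (sub_nonneg.mpr hu.2)] at h
      rw [hx2]
      have h3 : exp (-(U / 2)) * exp u ≤ exp (U / 2) := by
        rw [← Real.exp_add]
        apply Real.exp_le_exp.mpr
        linarith [hu.2]
      have h2 := Real.add_one_le_exp ((U - u) / 2)
      have h4 : exp (U / 2) = exp (u / 2) * exp ((U - u) / 2) := by
        rw [← Real.exp_add]; congr 1; ring
      have h5 : exp (u / 2) * (U - u) + 1 ≤ 2 * exp (U / 2) := by
        rw [h4]; nlinarith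
      have h6 := mul_le_mul_of_nonneg_left h5 hc.le
      have h7 := mul_le_mul_of_nonneg_left h3 hc.le
      linarith
  have b3 : ∀ v ∈ Icc 0 U, Metric.ball x (c / 3) ⊆
      Wedge (c * v) (c * exp (v / 2)) (c * exp (-(v / 2))) := by
    intro v hv
    apply ball_subset_wedge
    · rw [abs_of_pos (by positivity)]
      have := hinv v hv.1
      nlinarith
    · have h := hN v
      rw [hx2]
      have h1 : exp (v / 2) = exp (u / 2) * exp (-((u - v) / 2)) := by
        rw [← Real.exp_add]; congr 1; ring
      have h2 : exp (-(v / 2)) * exp u = exp (u / 2) * exp ((u - v) / 2) := by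
        rw [← Real.exp_add, ← Real.exp_add]; congr 1; ring
      have h3 : |u - v| + 1 ≤ exp (-((u - v) / 2)) + exp ((u - v) / 2) := by
        have q : ∀ y : ℝ, 0 ≤ y → y + 1 ≤ exp (-(y / 2)) + exp (y / 2) := by
          intro y hy
          have g1 : y / 4 ≤ Real.sinh (y / 4) := Real.self_le_sinh_iff.mpr (by linarith)
          rw [Real.sinh_eq] at g1
          have g2 : exp (y / 2) = exp (y / 4) * exp (y / 4) := by
            rw [← Real.exp_add]; congr 1; ring
          have g3 : exp (-(y / 2)) = exp (-(y / 4)) * exp (-(y / 4)) := by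
            rw [← Real.exp_add]; congr 1; ring
          have g4 : exp (y / 4) * exp (-(y / 4)) = 1 := by
            rw [← Real.exp_add]; simp
          have g5 : (y / 2) ^ 2 ≤ (exp (y / 4) - exp (-(y / 4))) ^ 2 := by
            apply pow_le_pow_left₀ (by linarith)
            linarith
          rw [g2, g3]
          nlinarith [sq_nonneg (y / 2 - 1)]
        rcases le_total 0 (u - v) with h' | h'
        · rw [abs_of_nonneg h']; exact q _ h'
        · rw [abs_of_nonpos h']
          have := q (-(u - v)) (by linarith)
          rw [neg_div, neg_neg] at this
          linarith
      have h4 : exp (u / 2) * |u - v| + 1 ≤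
          exp (v / 2) + exp (-(v / 2)) * exp u := by
        rw [h1, h2]; nlinarith
      have h5 := mul_le_mul_of_nonneg_left h4 hc.le
      linarith
  refine mem_interior.mpr ⟨Metric.ball x (c / 3), ?_, Metric.isOpen_ball,
    Metric.mem_ball_self (by positivity)⟩
  exact subset_inter (subset_inter b1 b2) (subset_iInter₂ b3)

/-- The spiralling curve. -/
def spiral (c u : ℝ) : E3 :=
  pt (-(2 * c * exp (u / 2) * Real.sin (c * u))) (2 * c * exp (u / 2) * Real.cos (c * u)) (exp u)

lemma spiral_dist {c u v : ℝ} (hc : 0 < c) (hc1 : 2 * c ≤ 1) (huv : u ≤ v) :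
    dist (spiral c u) (spiral c v) ≤ (exp v + 4 * c ^ 2 * v) - (exp u + 4 * c ^ 2 * u) := by
  have hle : exp u ≤ exp v := Real.exp_le_exp.mpr huv
  have hR : 0 ≤ (exp v + 4 * c ^ 2 * v) - (exp u + 4 * c ^ 2 * u) := by nlinarith [sq_nonneg c]
  apply le_of_sq_le_sq _ hR
  rw [dist_sq_E3]
  simp only [spiral, pt_zero, pt_one, pt_two]
  set A := exp (u / 2) with hA
  set B := exp (v / 2) with hB
  have hA0 : 0 < A := Real.exp_pos _
  have hB0 : 0 < B := Real.exp_pos _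
  rw [exp_half_sq u, exp_half_sq v, ← hA, ← hB]
  set x := v - u with hx
  have hx0 : 0 ≤ x := by linarith
  have hBA : B = A * exp (x / 2) := by rw [hA, hB, ← Real.exp_add]; congr 1; rw [hx]; ring
  have hAB : A = B * exp (-(x / 2)) := by rw [hA, hB, ← Real.exp_add]; congr 1; rw [hx]; ring
  have g1 : A * x / 2 ≤ B - A := by
    have := Real.add_one_le_exp (x / 2)
    have := mul_le_mul_of_nonneg_left this hA0.le
    linarith
  have g2 : B - A ≤ B * x / 2 := by
    have := Real.add_one_le_exp (-(x / 2))
    have := mul_le_mul_of_nonneg_left this hB0.le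
    linarith
  have g3 := Real.one_sub_sq_div_two_le_cos (x := c * x)
  have hD : 0 ≤ B - A := le_trans (by positivity) g1
  have hcx : Real.cos (c * x) = Real.cos (c * v) * Real.cos (c * u)
      + Real.sin (c * v) * Real.sin (c * u) := by
    rw [hx, mul_sub, Real.cos_sub]
  have main : A ^ 2 + B ^ 2 - 2 * A * B * Real.cos (c * x) ≤ 2 * x * (B - A) * (B + A) := by
    have k1 : A ^ 2 + B ^ 2 - 2 * A * B * Real.cos (c * x) ≤ (B - A) ^ 2 + A * B * (c * x) ^ 2 := by
      have := mul_le_mul_of_nonneg_left g3 (mul_pos hA0 hB0).le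
      nlinarith
    have k2 : (B - A) ^ 2 ≤ (B - A) * (B * x / 2) := by nlinarith
    have k3 : A * B * (c * x) ^ 2 ≤ (B - A) * (B * x) := by
      have c2 : c ^ 2 ≤ 1 / 2 := by nlinarith
      have : A * B * (c * x) ^ 2 ≤ A * B * (1 / 2 * x ^ 2) := by
        rw [mul_pow]; gcongr
      have := mul_le_mul_of_nonneg_right g1 (mul_nonneg hB0.le hx0)
      nlinarith
    have k4 : 0 ≤ (B - A) * (A * x) := by positivity
    have k5 : 0 ≤ (B - A) * (B * x) := by positivity
    nlinarith
  have expand : (-(2 * c * A * Real.sin (c * u)) - -(2 * c * B * Real.sin (c * v))) ^ 2 +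
      (2 * c * A * Real.cos (c * u) - 2 * c * B * Real.cos (c * v)) ^ 2 =
      4 * c ^ 2 * (A ^ 2 + B ^ 2 - 2 * A * B * Real.cos (c * x)) := by
    rw [hcx]
    linear_combination (4 * c ^ 2 * A ^ 2) * Real.sin_sq_add_cos_sq (c * u) +
      (4 * c ^ 2 * B ^ 2) * Real.sin_sq_add_cos_sq (c * v)
  rw [expand]
  have m2 := mul_le_mul_of_nonneg_left main (by positivity : 0 ≤ 4 * c ^ 2)
  have : (B * B + 4 * c ^ 2 * v - (A * A + 4 * c ^ 2 * u)) ^ 2 =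
      (A * A - B * B) ^ 2 + 4 * c ^ 2 * (2 * x * (B - A) * (B + A)) + (4 * c ^ 2 * x) ^ 2 := by
    rw [hx]; ring
  rw [this]
  nlinarith [sq_nonneg (4 * c ^ 2 * x)]

lemma spiral_continuous (c : ℝ) : Continuous (spiral c) := by
  unfold spiral pt
  simp only [WithLp.equiv_symm_apply]
  apply (PiLp.continuous_toLp 2 _).comp
  apply continuous_pi
  intro i
  fin_cases i <;> simp <;> fun_prop

lemma competitor {c U : ℝ} (hc : 0 < c) (hc1 : 2 * c ≤ 1) (hU : 0 ≤ U) {Q : Set E3}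
    (hQ : Q ⊆ Body c U) :
    ∃ V f, V ≤ 2 * exp U + 4 * c ^ 2 * (1 + U) ∧
      LipPath (interior Q)ᶜ (pt 0 0 0) (pt 0 0 (2 * exp U)) V f := by
  have hQ1 : Q ⊆ Wedge 0 0 (2 * c) := fun x hx => (hQ hx).1.1
  have hQ2 : Q ⊆ Wedge (c * U) (4 * c * exp (U / 2)) (-(2 * c * exp (-(U / 2)))) :=
    fun x hx => (hQ hx).1.2
  have hQ3 : ∀ v ∈ Icc 0 U, Q ⊆ Wedge (c * v) (c * exp (v / 2)) (c * exp (-(v / 2))) :=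
    fun v hv x hx => mem_iInter₂.mp (hQ hx).2 v hv
  have l1 : LipPath (interior Q)ᶜ (pt 0 0 0) (spiral c 0) _ _ := lipPath_segment (by
    intro r _
    apply not_mem_interior_of_wedge hQ1
    simp [NN, spiral]
    ring)
  have l3 : LipPath (interior Q)ᶜ (spiral c U) (pt 0 0 (2 * exp U)) _ _ := lipPath_segment (by
    intro r _
    apply not_mem_interior_of_wedge hQ2
    have e1 : exp (-(U / 2)) * exp U = exp (U / 2) := by
      rw [← Real.exp_add]; congr 1; ring
    have e2 := Real.sin_sq_add_cos_sq (c * U)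
    simp only [NN, spiral, PiLp.add_apply, PiLp.smul_apply, PiLp.sub_apply, pt_zero, pt_one,
      pt_two, smul_eq_mul]
    linear_combination (2 * c * exp (U / 2) * (1 - r)) * e2 + 2 * c * (1 + r) * e1)
  obtain ⟨f2, l2⟩ : ∃ f, LipPath (interior Q)ᶜ (spiral c 0) (spiral c U)
      (exp U - 1 + 4 * c ^ 2 * U) f := by
    apply reparam (v := fun u => exp u - 1 + 4 * c ^ 2 * u) hU (spiral_continuous c).continuousOn
    · intro s _ t _ hst
      have := spiral_dist hc hc1 hst
      linarith
    · simp
    · exact le_rfl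
    · intro u hu
      apply not_mem_interior_of_wedge (hQ3 u hu)
      have e1 : exp (-(u / 2)) * exp u = exp (u / 2) := by
        rw [← Real.exp_add]; congr 1; ring
      have e2 := Real.sin_sq_add_cos_sq (c * u)
      simp only [NN, spiral, pt_zero, pt_one, pt_two]
      linear_combination (2 * c * exp (u / 2)) * e2 - c * e1
  obtain ⟨g, hg⟩ := l1.trans l2
  obtain ⟨h, hh⟩ := hg.trans l3
  refine ⟨_, h, ?_, hh⟩
  have d1 : dist (pt 0 0 0) (spiral c 0) ≤ 1 + 2 * c ^ 2 := by
    apply le_of_sq_le_sq _ (by positivity)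
    rw [dist_sq_E3]
    simp [spiral]
    nlinarith [sq_nonneg (c ^ 2)]
  have d3 : dist (spiral c U) (pt 0 0 (2 * exp U)) ≤ exp U + 2 * c ^ 2 := by
    apply le_of_sq_le_sq _ (by positivity)
    rw [dist_sq_E3]
    simp only [spiral, pt_zero, pt_one, pt_two, sub_zero]
    have e2 := Real.sin_sq_add_cos_sq (c * U)
    have e3 := exp_half_sq U
    have : (-(2 * c * exp (U / 2) * Real.sin (c * U))) ^ 2 +
        (2 * c * exp (U / 2) * Real.cos (c * U)) ^ 2 = 4 * c ^ 2 * exp U := by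
      rw [e3]
      linear_combination (4 * c ^ 2 * exp (U / 2) ^ 2) * e2
    rw [this]
    nlinarith [sq_nonneg (c ^ 2)]
  linarith

lemma isSimplyConnected_Ioo : IsSimplyConnected (Ioo (0:ℝ) 1) := by
  have h : ContractibleSpace (Ioo (0:ℝ) 1) :=
    (convex_Ioo (0:ℝ) 1).contractibleSpace ⟨1/2, by norm_num, by norm_num⟩
  exact inferInstanceAs (SimplyConnectedSpace (Ioo (0:ℝ) 1))

lemma exists_angle {f : ℝ → E3} (hf : ContinuousOn f (Ioo 0 1))
    (h0 : ∀ t ∈ Ioo (0:ℝ) 1, ¬ (f t 0 = 0 ∧ f t 1 = 0)) :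
    ∃ φ ρ : ℝ → ℝ, ContinuousOn φ (Ioo 0 1) ∧ ContinuousOn ρ (Ioo 0 1) ∧
      ∀ t ∈ Ioo (0 : ℝ) 1, 0 < ρ t ∧
        f t 0 = ρ t * Real.cos (φ t) ∧ f t 1 = ρ t * Real.sin (φ t) := by
  have hc : ∀ i, ContinuousOn (fun t => f t i) (Ioo 0 1) := fun i =>
    (PiLp.continuous_apply 2 _ i).comp_continuousOn hf
  obtain ⟨L, hL, hE⟩ := Complex.exists_continuousOn_eqOn_exp_comp
    (g := fun t => ((f t 0 : ℝ) : ℂ) + ((f t 1 : ℝ) : ℂ) * Complex.I)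
    isSimplyConnected_Ioo isOpen_Ioo
    ((Complex.continuous_ofReal.comp_continuousOn (hc 0)).add
      ((Complex.continuous_ofReal.comp_continuousOn (hc 1)).mul continuousOn_const))
    (by
      rintro ⟨t, ht, h⟩
      apply h0 t ht
      have h1 := congrArg Complex.re h
      have h2 := congrArg Complex.im h
      simp at h1 h2
      exact ⟨h1, h2⟩)
  refine ⟨fun t => (L t).im, fun t => exp (L t).re,
    Complex.continuous_im.comp_continuousOn hL,
    Real.continuous_exp.comp_continuousOn (Complex.continuous_re.comp_continuousOn hL), ?_⟩
  intro t ht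
  have h := hE ht
  simp only [Function.comp_apply] at h
  refine ⟨Real.exp_pos _, ?_, ?_⟩
  · have h1 := congrArg Complex.re h
    simp [Complex.exp_re] at h1
    exact h1.symm
  · have h1 := congrArg Complex.im h
    simp [Complex.exp_im] at h1
    exact h1.symm

/-- A continuous real function on an interval on which `sin` never vanishes varies by less
than `π`. -/
lemma sin_ne_zero_var {D : ℝ → ℝ} {p q : ℝ} (hpq : p ≤ q) (hD : ContinuousOn D (Icc p q))
    (h : ∀ t ∈ Icc p q, Real.sin (D t) ≠ 0) : |D q - D p| ≤ π := by
  by_contra hcon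
  push Not at hcon
  have hm : ∃ k : ℤ, (k:ℝ) * π ∈ uIcc (D p) (D q) := by
    have hpi := Real.pi_pos
    refine ⟨⌈min (D p) (D q) / π⌉, ?_⟩
    have h1 := Int.le_ceil (min (D p) (D q) / π)
    have h2 := Int.ceil_lt_add_one (min (D p) (D q) / π)
    rw [div_le_iff₀ hpi] at h1
    have h3 : (⌈min (D p) (D q) / π⌉ : ℝ) * π < min (D p) (D q) + π := by
      have := mul_lt_mul_of_pos_right h2 hpi
      rwa [add_mul, div_mul_cancel₀ _ hpi.ne', one_mul] at this
    constructor
    · exact h1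
    · have h4 : max (D p) (D q) - min (D p) (D q) = |D q - D p| := max_sub_min_eq_abs _ _
      show _ ≤ max (D p) (D q)
      linarith
  obtain ⟨k, hk⟩ := hm
  have := intermediate_value_uIcc (f := D) (a := p) (b := q) (by rwa [uIcc_of_le hpq]) hk
  obtain ⟨t, ht, hkt⟩ := this
  rw [uIcc_of_le hpq] at ht
  apply h t ht
  rw [hkt]
  exact Real.sin_int_mul_pi k

lemma exists_crossing {z : ℝ → ℝ} (hz : ContinuousOn z (Icc 0 1)) {p q : ℝ} (hp : z 0 < p)
    (hpq : p < q) (hq : q < z 1) :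
    ∃ s t, s ∈ Ioo (0:ℝ) 1 ∧ t ∈ Ioo (0:ℝ) 1 ∧ s ≤ t ∧ z s = p ∧ z t = q ∧
      ∀ r ∈ Icc s t, z r ∈ Icc p q := by
  -- first time at height `q`
  let T : Set ℝ := Icc 0 1 ∩ z ⁻¹' Ici q
  have hT : IsClosed T := hz.preimage_isClosed_of_isClosed isClosed_Icc isClosed_Ici
  have hTb : BddBelow T := ⟨0, fun x hx => hx.1.1⟩
  have hTne : T.Nonempty := ⟨1, by simp, hq.le⟩
  have htT : sInf T ∈ T := hT.csInf_mem hTne hTb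
  set t := sInf T with ht
  have hbefore : ∀ r ∈ Icc 0 t, r ≠ t → z r < q := by
    intro r hr hrt
    by_contra hcon
    have : t ≤ r := csInf_le hTb ⟨⟨hr.1, hr.2.trans htT.1.2⟩, not_lt.mp hcon⟩
    exact hrt (le_antisymm hr.2 this)
  have hz' : ContinuousOn z (Icc 0 t) := hz.mono (Icc_subset_Icc_right htT.1.2)
  have hzt : z t = q := by
    have h1 : q ∈ Icc (z 0) (z t) := ⟨by linarith, htT.2⟩
    obtain ⟨r, hr, hrq⟩ := intermediate_value_Icc htT.1.1 hz' h1
    by_contra hcon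
    have := hbefore r hr (fun h => hcon (h ▸ hrq))
    linarith
  let T' : Set ℝ := Icc 0 t ∩ z ⁻¹' Iic p
  have hT' : IsClosed T' := hz'.preimage_isClosed_of_isClosed isClosed_Icc isClosed_Iic
  have hTb' : BddAbove T' := ⟨t, fun x hx => hx.1.2⟩
  have hTne' : T'.Nonempty := ⟨0, ⟨le_rfl, htT.1.1⟩, hp.le⟩
  have hsT : sSup T' ∈ T' := hT'.csSup_mem hTne' hTb'
  set s := sSup T' with hs
  have hafter : ∀ r ∈ Icc s t, r ≠ s → p < z r := by
    intro r hr hrs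
    by_contra hcon
    have : r ≤ s := le_csSup hTb' ⟨⟨hsT.1.1.trans hr.1, hr.2⟩, not_lt.mp hcon⟩
    exact hrs (le_antisymm this hr.1)
  have hzs : z s = p := by
    have h1 : p ∈ Icc (z s) (z t) := ⟨hsT.2, by linarith⟩
    obtain ⟨r, hr, hrq⟩ := intermediate_value_Icc hsT.1.2
      (hz'.mono (Icc_subset_Icc_left hsT.1.1)) h1
    by_contra hcon
    have := hafter r hr (fun h => hcon (h ▸ hrq))
    linarith
  have hs0 : 0 < s := lt_of_le_of_ne hsT.1.1 (fun h => by rw [← h] at hzs; linarith)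
  have ht1 : t < 1 := lt_of_le_of_ne htT.1.2 (fun h => by rw [h] at hzt; linarith)
  refine ⟨s, t, ⟨hs0, hsT.1.2.trans_lt ht1⟩, ⟨hs0.trans_le hsT.1.2, ht1⟩, hsT.1.2, hzs, hzt, ?_⟩
  intro r hr
  constructor
  · by_cases h : r = s
    · rw [h, hzs]
    · exact (hafter r hr h).le
  · by_cases h : r = t
    · rw [h, hzt]
    · exact (hbefore r ⟨hsT.1.1.trans hr.1, hr.2⟩ h).le

lemma exists_polytope {c U : ℝ} (hc : 0 < c) (hc1 : 2 * c ≤ 1) (hU : 0 ≤ U) :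
    ∃ F : Finset E3, pt 0 0 0 ∈ F ∧ pt 0 0 (2 * exp U) ∈ F ∧
      convexHull ℝ (F : Set E3) ⊆ Body c U ∧
      ∀ u ∈ Icc 0 U, ∀ s, |s| ≤ exp (u / 2) →
        pt (s * Real.cos (c * u)) (s * Real.sin (c * u)) (exp u) ∈
          interior (convexHull ℝ (F : Set E3)) := by
  classical
  let h : ℝ × ℝ → E3 := fun w => pt (w.2 * exp (w.1 / 2) * Real.cos (c * w.1))
    (w.2 * exp (w.1 / 2) * Real.sin (c * w.1)) (exp w.1)
  have hcont : Continuous h := by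
    simp only [h, pt, WithLp.equiv_symm_apply]
    apply (PiLp.continuous_toLp 2 _).comp
    apply continuous_pi
    intro i
    fin_cases i <;> simp <;> fun_prop
  let H : Set E3 := h '' (Icc 0 U ×ˢ Icc (-1) 1)
  have hH : IsCompact H := (isCompact_Icc.prod isCompact_Icc).image hcont
  have hHB : H ⊆ interior (Body c U) := by
    rintro _ ⟨⟨u, r⟩, ⟨hu, hr⟩, rfl⟩
    apply helicoid_mem_interior hc hc1 hu
    rw [abs_mul, abs_of_pos (Real.exp_pos _)]
    have := abs_le.mpr hr
    have := Real.exp_pos (u/2)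
    simp only
    nlinarith
  obtain ⟨F, hF1, hF2⟩ : ∃ F : Finset E3, H ⊆ interior (convexHull ℝ (F : Set E3)) ∧
      convexHull ℝ (F : Set E3) ⊆ Body c U := by
    refine hH.induction_on (p := fun S => ∃ F : Finset E3,
      S ⊆ interior (convexHull ℝ (F : Set E3)) ∧ convexHull ℝ (F : Set E3) ⊆ Body c U) ?_ ?_ ?_ ?_
    · exact ⟨∅, by simp, by simp⟩
    · rintro S T hST ⟨F, h1, h2⟩
      exact ⟨F, hST.trans h1, h2⟩
    · rintro S T ⟨F, h1, h2⟩ ⟨G, h3, h4⟩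
      refine ⟨F ∪ G, union_subset (h1.trans (interior_mono (convexHull_mono ?_)))
        (h3.trans (interior_mono (convexHull_mono ?_))), convexHull_min ?_ (convex_body c U)⟩
      · simp
      · simp
      · rw [Finset.coe_union]
        exact union_subset ((subset_convexHull ℝ _).trans h2) ((subset_convexHull ℝ _).trans h4)
    · intro x hx
      obtain ⟨F, h1, h2⟩ :=
        (convex_singleton (𝕜 := ℝ) x).exists_subset_interior_convexHull_finset_of_isCompact
          isCompact_singleton (t := Body c U)
          (subset_interior_iff_mem_nhdsSet.mp (singleton_subset_iff.mpr (hHB hx)))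
      refine ⟨interior (convexHull ℝ (F : Set E3)), mem_nhdsWithin_of_mem_nhds
        (isOpen_interior.mem_nhds (h1 rfl)), F, subset_rfl, h2⟩
  have hexp : ∀ w, exp (-(w / 2)) * exp w = exp (w / 2) := by
    intro w; rw [← Real.exp_add]; congr 1; ring
  have haB : pt 0 0 0 ∈ Body c U := by
    refine ⟨⟨?_, ?_⟩, mem_iInter₂.mpr fun v hv => ?_⟩ <;> simp [Wedge, NN] <;> positivity
  have hbB : pt 0 0 (2 * exp U) ∈ Body c U := by
    refine ⟨⟨?_, ?_⟩, mem_iInter₂.mpr fun v hv => ?_⟩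
    · simp [Wedge, NN]; positivity
    · simp [Wedge, NN]
      have := hexp U
      nlinarith
    · simp [Wedge, NN]; positivity
  have hsub : (F : Set E3) ⊆ Body c U := (subset_convexHull ℝ _).trans hF2
  refine ⟨insert (pt 0 0 0) (insert (pt 0 0 (2 * exp U)) F), by simp, by simp, ?_, ?_⟩
  · apply convexHull_min _ (convex_body c U)
    intro x hx
    simp only [Finset.coe_insert, mem_insert_iff, Finset.mem_coe] at hx
    rcases hx with rfl | rfl | hx
    · exact haB
    · exact hbB
    · exact hsub hx
  · intro u hu s hs
    have h1 : pt (s * Real.cos (c * u)) (s * Real.sin (c * u)) (exp u) ∈ H := by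
      refine ⟨(u, s / exp (u / 2)), ⟨hu, ?_⟩, ?_⟩
      · apply abs_le.mp
        rw [abs_div, abs_of_pos (Real.exp_pos _), div_le_one (Real.exp_pos _)]
        exact hs
      · simp only [h]
        rw [div_mul_cancel₀ _ (Real.exp_pos _).ne']
    have h2 := hF1 h1
    refine interior_mono (convexHull_mono ?_) h2
    intro x hx
    simp [hx]

lemma dist_ge_coord (x y : E3) : |x 2 - y 2| ≤ dist x y := abs_coord_le x y 2

lemma radius_bound {x : E3} {A ℓ : ℝ} (S : ℝ) (hS : S ^ 2 = x 0 ^ 2 + x 1 ^ 2)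
    (hz : 1 ≤ x 2) (hl : dist (pt 0 0 0) x + dist x (pt 0 0 A) ≤ ℓ) (hA : ℓ ≤ A + 1 / 4) :
    S ^ 2 ≤ x 2 := by
  have h1 := abs_coord_le x (pt 0 0 A) 2
  rw [pt_two, abs_le] at h1
  have h2 : dist (pt 0 0 0) x ≤ x 2 + 1 / 4 := by linarith [h1.1]
  have h3 := dist_sq_E3 (pt 0 0 0) x
  simp only [pt_zero, pt_one, pt_two] at h3
  have h4 : dist (pt 0 0 0) x ^ 2 ≤ (x 2 + 1 / 4) ^ 2 :=
    pow_le_pow_left₀ dist_nonneg h2 2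
  nlinarith

lemma axis_points {c U : ℝ} {Q : Set E3} (hc : 0 < c) (hQ : Convex ℝ Q) (hB : Q ⊆ Body c U)
    (ha : pt 0 0 0 ∈ Q) (hb : pt 0 0 (2 * exp U) ∈ Q) (hU : 0 ≤ U)
    (hi : pt 0 0 1 ∈ interior Q) {x : E3} (hxQ : x ∈ Q) (hx : x ∉ interior Q)
    (h0 : x 0 = 0) (h1 : x 1 = 0) : x = pt 0 0 0 ∨ x = pt 0 0 (2 * exp U) := by
  have hb1 := hB hxQ
  have hw1 := hb1.1.1
  have hw2 := hb1.1.2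
  simp only [Wedge, NN, mem_ofPred_eq, h0, h1, mul_zero, add_zero, abs_zero, zero_add] at hw1 hw2
  have hz0 : 0 ≤ x 2 := by
    by_contra h
    push Not at h
    nlinarith
  have hE := Real.add_one_le_exp U
  have hprod : exp (-(U / 2)) * exp (U / 2) = 1 := by
    rw [← Real.exp_add]; simp
  have hp1 := Real.exp_pos (U / 2)
  have hp2 := Real.exp_pos (-(U / 2))
  have hz1 : x 2 ≤ 2 * exp U := by
    have h3 : 0 ≤ 2 * exp (U / 2) - exp (-(U / 2)) * x 2 := by
      by_contra h
      push Not at h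
      nlinarith
    have h4 : 0 ≤ exp (U / 2) * (2 * exp (U / 2) - exp (-(U / 2)) * x 2) :=
      mul_nonneg hp1.le h3
    have h5 := exp_half_sq U
    have h6 : exp (U / 2) * (2 * exp (U / 2) - exp (-(U / 2)) * x 2) =
      2 * (exp (U / 2) * exp (U / 2)) - (exp (-(U / 2)) * exp (U / 2)) * x 2 := by ring
    rw [h6, hprod, ← h5] at h4
    linarith
  by_contra hcon
  push Not at hcon
  have hz0' : 0 < x 2 := lt_of_le_of_ne hz0 fun h =>
    hcon.1 (E3_ext (by simp [h0]) (by simp [h1]) (by simp [← h]))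
  have hz1' : x 2 < 2 * exp U := lt_of_le_of_ne hz1 fun h =>
    hcon.2 (E3_ext (by simp [h0]) (by simp [h1]) (by simp [h]))
  apply hx
  rcases le_total (x 2) 1 with h | h
  · have := hQ.combo_interior_self_subset_interior (a := x 2) (b := 1 - x 2) hz0' (by linarith)
      (by ring)
    apply this
    refine ⟨_, ⟨_, hi, rfl⟩, _, ⟨_, ha, rfl⟩, ?_⟩
    apply E3_ext <;> simp [h0, h1]
  · have hd : 0 < 2 * exp U - 1 := by linarith
    have := hQ.combo_interior_self_subset_interior (a := (2 * exp U - x 2) / (2 * exp U - 1))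
      (b := (x 2 - 1) / (2 * exp U - 1)) (div_pos (by linarith) hd)
      (div_nonneg (by linarith) hd.le) (by field_simp; ring)
    apply this
    refine ⟨_, ⟨_, hi, rfl⟩, _, ⟨_, hb, rfl⟩, ?_⟩
    apply E3_ext
    · simp [h0]
    · simp [h1]
    · simp; field_simp; ring

/-- **Theorem 4 (Bárány–Kuperberg–Zamfirescu).** For every `n` there is a convex
polytope `Q ⊆ ℝ³` and a shortest path `γ` between two boundary points
`a = (0,0,h₁)` and `b = (0,0,h₂)` on the axis, such that `γ` spirals at least `n`
times around the line through `a` and `b`: a continuous determination `φ` of the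
angular cylindrical coordinate along `γ` varies by at least `2πn`. -/
theorem exists_shortest_path_spiralling (n : ℕ) :
    ∃ (F : Finset E3) (Q : Set E3) (h₁ h₂ : ℝ) (γ : ℝ → E3) (φ ρ : ℝ → ℝ),
      Q = convexHull ℝ (F : Set E3) ∧ (interior Q).Nonempty ∧ h₁ < h₂ ∧
      pt 0 0 h₁ ∈ frontier Q ∧ pt 0 0 h₂ ∈ frontier Q ∧
      ContinuousOn γ (Set.Icc 0 1) ∧ Set.MapsTo γ (Set.Icc 0 1) (frontier Q) ∧
      γ 0 = pt 0 0 h₁ ∧ γ 1 = pt 0 0 h₂ ∧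
      pathLength γ = geodesicDist (frontier Q) (pt 0 0 h₁) (pt 0 0 h₂) ∧
      ContinuousOn φ (Set.Ioo 0 1) ∧ ContinuousOn ρ (Set.Ioo 0 1) ∧
      (∀ t ∈ Set.Ioo (0 : ℝ) 1, 0 < ρ t ∧
        γ t 0 = ρ t * Real.cos (φ t) ∧ γ t 1 = ρ t * Real.sin (φ t)) ∧
      ∃ s t : ℝ, s ∈ Set.Ioo (0 : ℝ) 1 ∧ t ∈ Set.Ioo (0 : ℝ) 1 ∧
        2 * π * n ≤ |φ s - φ t| := by
  have hπ0 := Real.pi_pos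
  have hπ1 := Real.pi_lt_d2
  set m : ℝ := 2 * (n : ℝ) + 1 with hm
  have hm1 : 1 ≤ m := by
    have : (0 : ℝ) ≤ n := Nat.cast_nonneg n
    linarith
  obtain ⟨c, hcdef⟩ : ∃ c : ℝ, c = 1 / (100 * m) := ⟨_, rfl⟩
  have hcm : c * m = 1 / 100 := by rw [hcdef]; field_simp
  have hc : 0 < c := by rw [hcdef]; positivity
  have hc100 : c ≤ 1 / 100 := by nlinarith
  obtain ⟨U, hUdef⟩ : ∃ U : ℝ, U = m * π / c := ⟨_, rfl⟩
  have hcU : c * U = m * π := by rw [hUdef]; field_simp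
  have hU : 0 < U := by rw [hUdef]; positivity
  obtain ⟨F, haF, hbF, hFB, hint⟩ := exists_polytope hc (by linarith) hU.le
  obtain ⟨Q, hQ⟩ : ∃ Q : Set E3, Q = convexHull ℝ (F : Set E3) := ⟨_, rfl⟩
  rw [← hQ] at hFB hint
  have hQconv : Convex ℝ Q := hQ ▸ convex_convexHull ℝ _
  have hQc : IsCompact Q := by
    rw [hQ]; exact F.finite_toSet.isCompact_convexHull (𝕜 := ℝ)
  have ha : pt 0 0 0 ∈ Q := hQ ▸ subset_convexHull ℝ _ haF
  have hb : pt 0 0 (2 * exp U) ∈ Q := hQ ▸ subset_convexHull ℝ _ hbF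
  have hi : pt 0 0 1 ∈ interior Q := by
    have := hint 0 ⟨le_rfl, hU.le⟩ 0 (by simp [(Real.exp_pos _).le])
    simpa using this
  obtain ⟨V, f₀, hV, hf₀⟩ := competitor hc (by linarith) hU.le hFB
  have hV' : V ≤ 2 * exp U + 1 / 4 := by
    have : 4 * c ^ 2 * (1 + U) = 4 * c ^ 2 + 4 * (c * m) * π := by
      have : 4 * c ^ 2 * (1 + U) = 4 * c ^ 2 + 4 * c * (c * U) := by ring
      rw [this, hcU]; ring
    rw [this, hcm] at hV
    nlinarith
  obtain ⟨g₀, hg₀⟩ := hf₀.project hQconv hQc ha hb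
  have hfc : IsCompact (frontier Q) :=
    hQc.of_isClosed_subset isClosed_frontier hQc.isClosed.frontier_subset
  obtain ⟨f, ℓ, hf, hlen, hmin⟩ := exists_shortest hfc hg₀
  have hℓ : ℓ ≤ 2 * exp U + 1 / 4 := (hmin _ _ hg₀).trans hV'
  have hEU := Real.exp_pos U
  have hab : pt 0 0 0 ≠ pt 0 0 (2 * exp U) := by
    intro h
    have := congrArg (fun x : E3 => x 2) h
    simp at this
  have hfront : ∀ t ∈ Icc (0 : ℝ) 1, f t ∈ Q ∧ f t ∉ interior Q := by
    intro t ht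
    have h := hf.2.2.1 t ht
    exact ⟨hQc.isClosed.frontier_subset h, h.2⟩
  have haxis : ∀ t ∈ Ioo (0 : ℝ) 1, ¬(f t 0 = 0 ∧ f t 1 = 0) := by
    rintro t ht ⟨h0, h1⟩
    have hne := hf.ne_left hab hmin ht
    have hfr := hfront t (Ioo_subset_Icc_self ht)
    rcases axis_points hc hQconv hFB ha hb hU.le hi hfr.1 hfr.2 h0 h1 with h | h
    · exact hne.1 h
    · exact hne.2 h
  obtain ⟨φ, ρ, hφ, hρ, hφρ⟩ :=
    exists_angle (hf.continuousOn.mono Ioo_subset_Icc_self) haxis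
  have hzc : ContinuousOn (fun t => f t 2) (Icc 0 1) :=
    (EuclideanSpace.proj (𝕜 := ℝ) (2 : Fin 3)).continuous.comp_continuousOn hf.continuousOn
  have hone : 1 < exp U := by simpa using hU
  obtain ⟨s, t, hs, ht, hst, hzs, hzt, hzr⟩ := exists_crossing (p := 1) (q := exp U) hzc
    (by simp [hf.1]) hone (by simp only [hf.2.1, pt_two]; linarith)
  have hsub : Icc s t ⊆ Ioo 0 1 := fun r hr => ⟨hs.1.trans_le hr.1, hr.2.trans_lt ht.2⟩
  have hD : ContinuousOn (fun r => φ r - c * Real.log (f r 2)) (Icc s t) := by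
    apply (hφ.mono hsub).sub
    apply continuousOn_const.mul
    apply (hzc.mono (hsub.trans Ioo_subset_Icc_self)).log
    intro r hr
    have := (hzr r hr).1
    simp only at this
    linarith
  have hsin : ∀ r ∈ Icc s t, Real.sin (φ r - c * Real.log (f r 2)) ≠ 0 := by
    intro r hr h0
    have hr01 := Ioo_subset_Icc_self (hsub hr)
    obtain ⟨hz1, hz2⟩ := hzr r hr
    simp only at hz1 hz2
    obtain ⟨hρ0, hx0, hx1⟩ := hφρ r (hsub hr)
    have hzpos : 0 < f r 2 := by linarith
    set u := Real.log (f r 2) with hu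
    have heu : exp u = f r 2 := Real.exp_log hzpos
    have hu0 : 0 ≤ u := Real.log_nonneg hz1
    have hu1 : u ≤ U := by rwa [← Real.exp_le_exp, heu]
    set S := ρ r * Real.cos (φ r - c * u) with hS
    have hd : φ r = (φ r - c * u) + c * u := by ring
    have e0 : f r 0 = S * Real.cos (c * u) := by
      rw [hx0, hd, Real.cos_add, h0, hS]; ring_nf
    have e1 : f r 1 = S * Real.sin (c * u) := by
      rw [hx1, hd, Real.sin_add, h0, hS]; ring_nf
    have hS2 : S ^ 2 = f r 0 ^ 2 + f r 1 ^ 2 := by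
      rw [e0, e1]
      have := Real.sin_sq_add_cos_sq (c * u)
      linear_combination (-S ^ 2) * this
    have hl : dist (pt 0 0 0) (f r) + dist (f r) (pt 0 0 (2 * exp U)) ≤ ℓ := by
      have d1 := hf.2.2.2 0 ⟨le_rfl, zero_le_one⟩ r hr01
      have d2 := hf.2.2.2 r hr01 1 ⟨zero_le_one, le_rfl⟩
      rw [hf.1, abs_of_nonpos (by linarith [hr01.1])] at d1
      rw [hf.2.1, abs_of_nonpos (by linarith [hr01.2])] at d2
      linarith
    have hb2 := radius_bound S hS2 hz1 hl hℓ
    have hSb : |S| ≤ exp (u / 2) := by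
      apply abs_le_of_sq_le_sq _ (Real.exp_pos _).le
      rw [sq (exp (u / 2)), ← exp_half_sq, heu]
      exact hb2
    apply (hfront r hr01).2
    have := hint u ⟨hu0, hu1⟩ S hSb
    rw [← e0, ← e1, heu] at this
    convert this using 1
    apply E3_ext <;> simp
  have hvar := sin_ne_zero_var hst hD hsin
  simp only at hvar hzs hzt
  rw [hzs, hzt, Real.log_exp, Real.log_one, hcU] at hvar
  refine ⟨F, Q, 0, 2 * exp U, f, φ, ρ, hQ, ⟨_, hi⟩, by linarith, ?_, ?_, hf.continuousOn,
    fun r hr => hf.2.2.1 r hr, hf.1, hf.2.1, hlen, hφ, hρ, hφρ, t, s, ht, hs, ?_⟩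
  · have := hf.2.2.1 0 ⟨le_rfl, zero_le_one⟩
    rwa [hf.1] at this
  · have := hf.2.2.1 1 ⟨zero_le_one, le_rfl⟩
    rwa [hf.2.1] at this
  · refine le_trans ?_ (le_abs_self _)
    have := (abs_le.mp hvar).1
    rw [hm] at this
    linarith
end
end
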